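/- arXiv:1202.4988 — 11 statements merged into one kernel-verified Lean document; each statement's English description precedes it below -/
import Mathlib

section
/- Let G be a finite abelian group and p an odd prime. Suppose there exists an automorphism α of G of order p whose only fixed point is the identity element of G. Then the group ℤ_p × G is not a CI-group with respect to color ternary relational structures. -/
/-- `σ` is an isomorphism from the color ternary relational structure `(V, E)`
to `(V, E')`. -/
def IsColorTernaryIso {V : Type*} {c : ℕ} (σ : Equiv.Perm V)
    (E E' : Fin c → Set (V × V × V)) : Prop :=
  ∀ i : Fin c, ∀ u v w : V, (σ u, σ v, σ w) ∈ E' i ↔ (u, v, w) ∈ E i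

/-- `(G, E)` is a Cayley color ternary relational structure of `G`, i.e. the left
regular representation of `G` consists of automorphisms. -/
def IsCayleyColorTernary (G : Type*) [Group G] {c : ℕ}
    (E : Fin c → Set (G × G × G)) : Prop :=
  ∀ g : G, IsColorTernaryIso (Equiv.mulLeft g) E E

/-- `G` is a CI-group with respect to color ternary relational structures. -/
def IsCIGroupColorTernary (G : Type*) [Group G] : Prop :=
  ∀ (c : ℕ) (E E' : Fin c → Set (G × G × G)),
    Pairwise (Function.onFun Disjoint E) → Pairwise (Function.onFun Disjoint E') →
    IsCayleyColorTernary G E → IsCayleyColorTernary G E' →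
    (∃ σ : Equiv.Perm G, IsColorTernaryIso σ E E') →
    ∃ φ : G ≃* G, IsColorTernaryIso φ.toEquiv E E'

open Multiplicative in
/-- Every element of order dividing `p` is the image of the generator under a homomorphism
from the cyclic group of order `p`. -/
theorem exists_zmod_monoidHom_apply_eq {H : Type*} [Group H] {p : ℕ} (a : H) (ha : a ^ p = 1) :
    ∃ f : Multiplicative (ZMod p) →* H, f (ofAdd 1) = a := by
  refine ⟨AddMonoidHom.toMultiplicativeLeft (ZMod.lift p
    ⟨zmultiplesHom (Additive H) (Additive.ofMul a), ?_⟩), ?_⟩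
  · simp [← ofMul_pow, ha]
  · have h := ZMod.lift_coe p ⟨zmultiplesHom (Additive H) (Additive.ofMul a), by
      simp [← ofMul_pow, ha]⟩ 1
    simp only [Int.cast_one] at h
    simp [h]

/-- Triples on three successive fibres of `C × G` whose `G`-coordinates satisfy the recurrence
`z * α x = y * α y`. -/
def recurrenceTriples {C G : Type*} [Group C] [Group G] (t : C) (α : MulAut G) :
    Set ((C × G) × (C × G) × (C × G)) :=
  {q | q.2.1.1 = t * q.1.1 ∧ q.2.2.1 = t * q.2.1.1 ∧
    q.2.2.2 * α q.1.2 = q.2.1.2 * α q.2.1.2}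

/-- Triples on three successive fibres of `C × G` whose `G`-coordinates satisfy the recurrence
`α z * x = y * α y`. -/
def reversedRecurrenceTriples {C G : Type*} [Group C] [Group G] (t : C) (α : MulAut G) :
    Set ((C × G) × (C × G) × (C × G)) :=
  {q | q.2.1.1 = t * q.1.1 ∧ q.2.2.1 = t * q.2.1.1 ∧
    α q.2.2.2 * q.1.2 = q.2.1.2 * α q.2.1.2}

/-- Triples in a single fibre of `C × G` with `z / x = α (y / x)`. -/
def fibreTriples {C G : Type*} [Group C] [Group G] (α : MulAut G) :
    Set ((C × G) × (C × G) × (C × G)) :=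
  {q | q.2.1.1 = q.1.1 ∧ q.2.2.1 = q.1.1 ∧ q.2.2.2 * q.1.2⁻¹ = α (q.2.1.2 * q.1.2⁻¹)}

section

variable {C G : Type*} [CommGroup C] [CommGroup G]

theorem isCayleyColorTernary_recurrence (t : C) (α : MulAut G) :
    IsCayleyColorTernary (C × G) ![recurrenceTriples t α, fibreTriples α] := by
  rintro ⟨c, h⟩ i ⟨u, x⟩ ⟨v, y⟩ ⟨w, z⟩
  have e : h * z * (α h * α x) = (h * α h) * (z * α x) := mul_mul_mul_comm _ _ _ _
  have e' : h * y * (α h * α y) = (h * α h) * (y * α y) := mul_mul_mul_comm _ _ _ _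
  fin_cases i
  · simp [recurrenceTriples, mul_left_comm t c, e, e']
  · simp only [fibreTriples, ← div_eq_mul_inv]
    simp [mul_div_mul_left_eq_div]

theorem isCayleyColorTernary_reversedRecurrence (t : C) (α : MulAut G) :
    IsCayleyColorTernary (C × G) ![reversedRecurrenceTriples t α, fibreTriples α] := by
  rintro ⟨c, h⟩ i ⟨u, x⟩ ⟨v, y⟩ ⟨w, z⟩
  have e : α h * α z * (h * x) = (h * α h) * (α z * x) := by
    rw [mul_mul_mul_comm, mul_comm h]
  have e' : h * y * (α h * α y) = (h * α h) * (y * α y) := mul_mul_mul_comm _ _ _ _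
  fin_cases i
  · simp [reversedRecurrenceTriples, mul_left_comm t c, e, e']
  · simp only [fibreTriples, ← div_eq_mul_inv]
    simp [mul_div_mul_left_eq_div]

theorem disjoint_recurrenceTriples {t : C} (ht : t ≠ 1) (α : MulAut G) :
    Disjoint (recurrenceTriples t α) (fibreTriples α) :=
  Set.disjoint_left.2 fun _ h h' => ht (mul_eq_right.1 (h.1.symm.trans h'.1))

theorem disjoint_reversedRecurrenceTriples {t : C} (ht : t ≠ 1) (α : MulAut G) :
    Disjoint (reversedRecurrenceTriples t α) (fibreTriples α) :=
  Set.disjoint_left.2 fun _ h h' => ht (mul_eq_right.1 (h.1.symm.trans h'.1))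

theorem pairwise_disjoint_cons_cons {β : Type*} {s t : Set β} (h : Disjoint s t) :
    Pairwise (Function.onFun Disjoint ![s, t]) := by
  intro i j hij
  fin_cases i <;> fin_cases j <;> simp_all [Function.onFun, disjoint_comm]

/-- Twisting the fibre over `c` by `(f c)⁻¹` carries the first recurrence to the reversed one. -/
theorem exists_isColorTernaryIso_recurrence (f : C →* MulAut G) (t : C) :
    ∃ σ : Equiv.Perm (C × G), IsColorTernaryIso σ
      ![recurrenceTriples t (f t), fibreTriples (f t)]
      ![reversedRecurrenceTriples t (f t), fibreTriples (f t)] := by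
  refine ⟨Equiv.prodShear (Equiv.refl C) fun c => (f c)⁻¹.toEquiv, ?_⟩
  rintro i ⟨u, x⟩ ⟨v, y⟩ ⟨w, z⟩
  have comm (a b : C) (g : G) : f a (f b g) = f b (f a g) := by
    rw [← MulAut.mul_apply, ← MulAut.mul_apply, ← map_mul, ← map_mul, mul_comm]
  have cancel (c : C) (g : G) : f c ((f c)⁻¹.toEquiv g) = g := MulAut.apply_inv_self _ _ _
  fin_cases i
  · simp only [recurrenceTriples, reversedRecurrenceTriples, Set.mem_ofPred_eq,
      Equiv.prodShear_apply, Fin.zero_eta, Matrix.cons_val_zero, Equiv.refl_apply]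
    refine and_congr_right fun hv => and_congr_right fun hw => ?_
    subst hv hw
    rw [← (f (t * u)).injective.eq_iff]
    have hz : f (t * u) (f t ((f (t * (t * u)))⁻¹.toEquiv z)) = z := by
      rw [← MulAut.mul_apply, ← map_mul, mul_comm (t * u), cancel]
    have hx : f (t * u) ((f u)⁻¹.toEquiv x) = f t x := by
      rw [map_mul, MulAut.mul_apply, cancel]
    rw [map_mul (f (t * u)), map_mul (f (t * u)), hz, hx, comm (t * u) t, cancel]
  · simp only [fibreTriples, Set.mem_ofPred_eq, Equiv.prodShear_apply, Fin.mk_one,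
      Matrix.cons_val_one, Matrix.cons_val_zero, Equiv.refl_apply]
    refine and_congr_right fun hv => and_congr_right fun hw => ?_
    subst hv hw
    rw [← (f w).injective.eq_iff, comm]
    simp only [map_mul, map_inv, cancel]

/-- A group automorphism carrying the first recurrence to the reversed one forces `α ^ 2 = 1`. -/
theorem sq_eq_one_of_isColorTernaryIso (t : C) (α : MulAut G) (φ : C × G ≃* C × G)
    (hφ : IsColorTernaryIso φ.toEquiv ![recurrenceTriples t α, fibreTriples α]
      ![reversedRecurrenceTriples t α, fibreTriples α]) : α ^ 2 = 1 := by
  have hfib (g : G) : (φ (1, g)).1 = 1 ∧ (φ (1, α g)).2 = α (φ (1, g)).2 := by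
    have h := (hφ 1 (1, 1) (1, g) (1, α g)).2 (by simp [fibreTriples])
    have h1 : φ (1, 1) = 1 := map_one φ
    simp only [fibreTriples, Matrix.cons_val_one, Matrix.cons_val_zero, Set.mem_ofPred_eq,
      MulEquiv.toEquiv_eq_coe, EquivLike.coe_coe, h1, Prod.fst_one,
      Prod.snd_one, inv_one, mul_one] at h
    exact ⟨h.1, h.2.2⟩
  have hrec (x : G) : α (φ (t * t, (α x)⁻¹)).2 * (φ (1, x)).2
      = (φ (t, 1)).2 * α (φ (t, 1)).2 :=
    ((hφ 0 (1, x) (t, 1) (t * t, (α x)⁻¹)).2 (by simp [recurrenceTriples])).2.2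
  have hsplit (g : G) : (φ (t * t, g⁻¹)).2 = (φ (t * t, 1)).2 * (φ (1, g)).2⁻¹ := by
    rw [← Prod.snd_inv, ← Prod.snd_mul, ← map_inv, ← map_mul]
    simp
  have key (x : G) : α (α (φ (1, x)).2) = (φ (1, x)).2 := by
    have hx := hrec x
    have h1 := hrec 1
    have hφ1 : φ (1, 1) = 1 := map_one φ
    rw [hsplit, (hfib x).2, map_mul, map_inv] at hx
    rw [map_one, inv_one, hφ1, Prod.snd_one, mul_one] at h1
    rw [← h1, mul_assoc, mul_eq_left, inv_mul_eq_one] at hx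
    exact hx
  ext x
  have h : φ (1, α (α x)) = φ (1, x) := by
    refine Prod.ext ?_ ?_
    · rw [(hfib _).1, (hfib _).1]
    · rw [(hfib _).2, (hfib _).2, key]
  simpa [pow_two] using congrArg Prod.snd (φ.injective h)

end

theorem statement_0 {G : Type*} [CommGroup G] [Fintype G]
    {p : ℕ} (hp : p.Prime) (hodd : Odd p)
    (α : MulAut G) (hord : orderOf α = p) (hfix : ∀ g : G, α g = g → g = 1) :
    ¬ IsCIGroupColorTernary (Multiplicative (ZMod p) × G) := by
  intro hCI
  have : Fact p.Prime := ⟨hp⟩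
  obtain ⟨f, hf⟩ := exists_zmod_monoidHom_apply_eq α (hord ▸ pow_orderOf_eq_one α)
  have ht : Multiplicative.ofAdd (1 : ZMod p) ≠ 1 := by simp
  obtain ⟨φ, hφ⟩ := hCI 2 _ _
    (pairwise_disjoint_cons_cons (disjoint_recurrenceTriples ht _))
    (pairwise_disjoint_cons_cons (disjoint_reversedRecurrenceTriples ht _))
    (isCayleyColorTernary_recurrence _ _) (isCayleyColorTernary_reversedRecurrence _ _)
    (exists_isColorTernaryIso_recurrence f _)
  have hsq := sq_eq_one_of_isColorTernaryIso _ _ φ hφ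
  rw [hf] at hsq
  have hdvd : p ∣ 2 := hord ▸ orderOf_dvd_of_pow_eq_one hsq
  rw [(Nat.prime_dvd_prime_iff_eq hp Nat.prime_two).1 hdvd] at hodd
  exact absurd hodd (by decide)
end

section
/- Let G be a finite abelian group and p an odd prime. Suppose there exists an automorphism α of G of order p whose only fixed point is the identity element of G, and suppose moreover that there exists a ternary relational structure on the vertex set G whose automorphism group equals the subgroup ⟨G_L, α⟩ of Sym(G). Then the group ℤ_p × G is not a CI-group with respect to ternary relational structures. -/
/-- `σ` is an isomorphism from the ternary relational structure `(V, E)` to `(V, E')`. -/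
def IsTernaryIso {V : Type*} (σ : Equiv.Perm V) (E E' : Set (V × V × V)) : Prop :=
  ∀ u v w : V, (σ u, σ v, σ w) ∈ E' ↔ (u, v, w) ∈ E

/-- `(G, E)` is a Cayley ternary relational structure of `G`. -/
def IsCayleyTernary (G : Type*) [Group G] (E : Set (G × G × G)) : Prop :=
  ∀ g : G, IsTernaryIso (Equiv.mulLeft g) E E

/-- `G` is a CI-group with respect to ternary relational structures. -/
def IsCIGroupTernary (G : Type*) [Group G] : Prop :=
  ∀ E E' : Set (G × G × G), IsCayleyTernary G E → IsCayleyTernary G E' →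
    (∃ σ : Equiv.Perm G, IsTernaryIso σ E E') →
    ∃ φ : G ≃* G, IsTernaryIso φ.toEquiv E E'

/-- The left regular representation of `G` as a subgroup of `Sym(G)`. -/
def leftRegular (G : Type*) [Group G] : Subgroup (Equiv.Perm G) :=
  (MulAction.toPermHom G G).range

/-- The ternary structure on `C × G` consisting of a copy of `Z` on every fibre of `C × G → C`,
together with the triples over `(t, c * t, c * (c * t))` whose `G`-coordinates satisfy `f`. -/
def fibredTernary {C G : Type*} [Mul C] (c : C) (Z : Set (G × G × G)) (f : G → G → G → Prop) :
    Set ((C × G) × (C × G) × (C × G)) :=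
  {t | (t.1.1 = t.2.1.1 ∧ t.1.1 = t.2.2.1 ∧ (t.1.2, t.2.1.2, t.2.2.2) ∈ Z) ∨
    (t.2.1.1 = c * t.1.1 ∧ t.2.2.1 = c * t.2.1.1 ∧ f t.1.2 t.2.1.2 t.2.2.2)}

theorem isCayleyTernary_fibredTernary {C G : Type*} [CommGroup C] [Group G] (c : C)
    {Z : Set (G × G × G)} {f : G → G → G → Prop} (hZ : IsCayleyTernary G Z)
    (hf : ∀ g x y z, f (g * x) (g * y) (g * z) ↔ f x y z) :
    IsCayleyTernary (C × G) (fibredTernary c Z f) := by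
  rintro ⟨s, g⟩ ⟨i, x⟩ ⟨j, y⟩ ⟨k, z⟩
  have h := hZ g x y z
  simp only [Equiv.coe_mulLeft] at h
  simp only [fibredTernary, Set.mem_ofPred_eq, Equiv.coe_mulLeft, Prod.mk_mul_mk, h, hf,
    mul_right_inj, mul_left_comm c s]

theorem isTernaryIso_pow {V : Type*} {σ : Equiv.Perm V} {E : Set (V × V × V)}
    (h : IsTernaryIso σ E E) (n : ℕ) : IsTernaryIso (σ ^ n) E E := by
  induction n with
  | zero => intro u v w; rfl
  | succ n ih =>
    intro u v w
    rw [pow_succ]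
    exact (ih _ _ _).trans (h u v w)

/-- The permutation of `C × G` acting on the fibre over `t` by `A t`. -/
def fibrewisePerm {C G : Type*} [Group G] (A : C → MulAut G) : Equiv.Perm (C × G) where
  toFun u := (u.1, A u.1 u.2)
  invFun u := (u.1, (A u.1).symm u.2)
  left_inv u := by simp
  right_inv u := by simp

theorem isTernaryIso_fibrewisePerm {C G : Type*} [Mul C] [Group G] {c : C} {A : C → MulAut G}
    {Z : Set (G × G × G)} {f f' : G → G → G → Prop}
    (hZ : ∀ t x y z, (A t x, A t y, A t z) ∈ Z ↔ (x, y, z) ∈ Z)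
    (hf : ∀ t x y z, f' (A t x) (A (c * t) y) (A (c * (c * t)) z) ↔ f x y z) :
    IsTernaryIso (fibrewisePerm A) (fibredTernary c Z f) (fibredTernary c Z f') := by
  rintro ⟨i, x⟩ ⟨j, y⟩ ⟨k, z⟩
  simp only [fibredTernary, fibrewisePerm, Set.mem_ofPred_eq, Equiv.coe_fn_mk]
  refine or_congr ?_ ?_
  · refine and_congr_right fun h1 => and_congr_right fun h2 => ?_
    subst h1 h2
    exact hZ _ _ _ _
  · refine and_congr_right fun h1 => and_congr_right fun h2 => ?_
    subst h1 h2
    exact hf _ _ _ _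

/-- Every element of `⟨G_L, α⟩` is a translate of an automorphism commuting with `α`. -/
theorem exists_commute_of_mem_closure {G : Type*} [Group G] (α : MulAut G) {σ : Equiv.Perm G}
    (hσ : σ ∈ Subgroup.closure
      ((leftRegular G : Set (Equiv.Perm G)) ∪ {MulEquiv.toEquiv α})) :
    ∃ (g : G) (β : MulAut G), Commute β α ∧ ∀ x, σ x = g * β x := by
  induction hσ using Subgroup.closure_induction with
  | mem σ h =>
    rcases h with ⟨g, rfl⟩ | h
    · exact ⟨g, 1, Commute.one_left _, fun x => rfl⟩
    · rw [Set.mem_singleton_iff] at h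
      subst h
      exact ⟨1, α, Commute.refl _, fun x => (one_mul _).symm⟩
  | one => exact ⟨1, 1, Commute.one_left _, fun x => (one_mul _).symm⟩
  | mul σ τ _ _ hs ht =>
    obtain ⟨g, β, hβ, h⟩ := hs
    obtain ⟨k, γ, hγ, h'⟩ := ht
    refine ⟨g * β k, β * γ, hβ.mul_left hγ, fun x => ?_⟩
    simp [h, h', mul_assoc]
  | inv σ _ hs =>
    obtain ⟨g, β, hβ, h⟩ := hs
    refine ⟨β⁻¹ g⁻¹, β⁻¹, hβ.inv_left, fun x => ?_⟩
    rw [Equiv.Perm.inv_eq_iff_eq, h, ← map_mul]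
    simp

theorem MulAut.not_dvd_card_of_fixedPointFree {G : Type*} [Group G] [Finite G] {p : ℕ}
    [hp : Fact p.Prime] (α : MulAut G) (hord : orderOf α = p) (hfix : ∀ g : G, α g = g → g = 1) :
    ¬ p ∣ Nat.card G := by
  have hP : IsPGroup p (Subgroup.zpowers α) :=
    IsPGroup.of_card (n := 1) (by rw [Nat.card_zpowers, hord, pow_one])
  have h := hP.card_modEq_card_fixedPoints G
  have h1 : MulAction.fixedPoints (Subgroup.zpowers α) G = {1} := by
    ext g
    rw [MulAction.mem_fixedPoints, Set.mem_singleton_iff]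
    refine ⟨fun hg => hfix g (hg ⟨α, Subgroup.mem_zpowers α⟩), ?_⟩
    rintro rfl ⟨m, _⟩
    exact map_one m
  rw [h1, Nat.card_coe_set_eq, Set.ncard_singleton] at h
  intro hd
  have := (h.symm.trans ((Nat.modEq_zero_iff_dvd).2 hd))
  rw [Nat.modEq_zero_iff_dvd] at this
  exact hp.out.one_lt.ne' (Nat.dvd_one.1 this)

theorem statement_1 {G : Type*} [CommGroup G] [Fintype G]
    {p : ℕ} (hp : p.Prime) (hodd : Odd p)
    (α : MulAut G) (hord : orderOf α = p) (hfix : ∀ g : G, α g = g → g = 1)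
    (hZ : ∃ E : Set (G × G × G),
      {σ : Equiv.Perm G | IsTernaryIso σ E E} =
        ↑(Subgroup.closure
            ((leftRegular G : Set (Equiv.Perm G)) ∪ {MulEquiv.toEquiv α}))) :
    ¬ IsCIGroupTernary (Multiplicative (ZMod p) × G) := by
  have : Fact p.Prime := ⟨hp⟩
  obtain ⟨Z, hZ⟩ := hZ
  have hmem : ∀ σ : Equiv.Perm G, IsTernaryIso σ Z Z ↔ σ ∈ Subgroup.closure
      ((leftRegular G : Set (Equiv.Perm G)) ∪ {MulEquiv.toEquiv α}) := fun σ =>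
    Set.ext_iff.1 hZ σ
  have hZL : IsCayleyTernary G Z := fun g =>
    (hmem _).2 (Subgroup.subset_closure (Or.inl ⟨g, rfl⟩))
  have hZα : IsTernaryIso (MulEquiv.toEquiv α⁻¹) Z Z :=
    (hmem _).2 (inv_mem (Subgroup.subset_closure (Or.inr rfl)))
  have hcop : Nat.Coprime p (Nat.card G) :=
    (Nat.Prime.coprime_iff_not_dvd hp).2 (α.not_dvd_card_of_fixedPointFree hord hfix)
  have hαp : α ^ p = 1 := hord ▸ pow_orderOf_eq_one α
  let c : Multiplicative (ZMod p) := Multiplicative.ofAdd 1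
  let A : Multiplicative (ZMod p) → MulAut G := fun t => α⁻¹ ^ (Multiplicative.toAdd t).val
  have hA : ∀ t, A (c * t) = α⁻¹ * A t := fun t => by
    change α⁻¹ ^ ((1 : ZMod p) + Multiplicative.toAdd t).val = _
    rw [← pow_succ', pow_inj_mod, orderOf_inv, hord, ZMod.val_add, Nat.mod_mod,
      ZMod.val_one, add_comm]
  have hAα : ∀ t x, A t (α x) = α (A t x) := fun t x => by
    have h : Commute (A t) α := ((Commute.refl α).inv_left).pow_left _
    exact DFunLike.congr_fun h.eq x
  have hAZ : ∀ t x y z, (A t x, A t y, A t z) ∈ Z ↔ (x, y, z) ∈ Z := fun t => by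
    have h : ((MulEquiv.toEquiv α⁻¹ : Equiv.Perm G)) ^ (Multiplicative.toAdd t).val =
        MulEquiv.toEquiv (A t) := (map_pow (MulAut.toPerm G) α⁻¹ _).symm
    have := isTernaryIso_pow hZα (Multiplicative.toAdd t).val
    rw [h] at this
    exact this
  intro hCI
  obtain ⟨φ, hφ⟩ := hCI (fibredTernary c Z fun x y z => α x * z = y * α y)
    (fibredTernary c Z fun x y z => x * α z = y * α y)
    (isCayleyTernary_fibredTernary c hZL fun g x y z => by
      rw [map_mul, map_mul, mul_mul_mul_comm, mul_mul_mul_comm g, mul_comm (α g),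
        mul_right_inj])
    (isCayleyTernary_fibredTernary c hZL fun g x y z => by
      rw [map_mul, map_mul, mul_mul_mul_comm, mul_mul_mul_comm g y, mul_right_inj])
    ⟨fibrewisePerm A, isTernaryIso_fibrewisePerm hAZ fun t x y z => by
      rw [← (α.injective.eq_iff), hA (c * t), hA t]
      simp only [map_mul, MulAut.mul_apply, MulAut.apply_inv_self]
      rw [← hAα, ← map_mul, ← hAα, ← map_mul, (A t).injective.eq_iff]⟩
  have hC : ∀ t : Multiplicative (ZMod p), t ^ p = 1 := fun t => by
    have := pow_card_eq_one' (x := t)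
    rwa [show Nat.card (Multiplicative (ZMod p)) = p from Nat.card_zmod p] at this
  have hφG : ∀ x : G, (φ (1, x)).1 = 1 := fun x => by
    have h : (φ (1, x)).1 ^ Nat.card G = 1 := by
      rw [← Prod.pow_fst, ← map_pow, Prod.pow_mk, one_pow, pow_card_eq_one']
      exact congrArg Prod.fst (map_one φ)
    exact orderOf_eq_one_iff.1 (Nat.eq_one_of_dvd_coprimes hcop
      (orderOf_dvd_of_pow_eq_one (hC _)) (orderOf_dvd_of_pow_eq_one h))
  have hφC : ∀ t : Multiplicative (ZMod p), (φ (t, 1)).2 = 1 := fun t => by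
    have h : (φ (t, 1)).2 ^ p = 1 := by
      rw [← Prod.pow_snd, ← map_pow, Prod.pow_mk, hC, one_pow]
      exact congrArg Prod.snd (map_one φ)
    exact orderOf_eq_one_iff.1 (Nat.eq_one_of_dvd_coprimes hcop
      (orderOf_dvd_of_pow_eq_one h) (orderOf_dvd_natCard _))
  let b : G →* G := (MonoidHom.snd _ G).comp (φ.toMonoidHom.comp (MonoidHom.inr _ G))
  have hb : ∀ t x, φ (t, x) = ((φ (t, 1)).1, b x) := fun t x => by
    have h : ((t, x) : Multiplicative (ZMod p) × G) = (t, 1) * (1, x) := by simp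
    rw [h, map_mul]
    ext
    · simp [hφG]
    · simp [hφC, b]
  have hb1 : ∀ x, φ (1, x) = (1, b x) := fun x => by rw [hb, hφG]
  have hbinj : Function.Injective b := fun x y h => by
    have := φ.injective ((hb1 x).trans (h ▸ (hb1 y).symm))
    exact (Prod.mk.inj this).2
  have hc1 : c ≠ 1 := fun h => one_ne_zero (α := ZMod p) h
  let β : Equiv.Perm G := Equiv.ofBijective b (Finite.injective_iff_bijective.1 hbinj)
  have hβ : IsTernaryIso β Z Z := fun x y z => by
    have h := hφ (1, x) (1, y) (1, z)
    change (φ _, φ _, φ _) ∈ _ ↔ _ at h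
    rw [hb1, hb1, hb1] at h
    simp only [fibredTernary, Set.mem_ofPred_eq, mul_one, hc1.symm, false_and, or_false,
      true_and] at h
    exact h
  have hcomm : ∀ x, b (α x) = α (b x) := by
    obtain ⟨g, γ, hγ, h⟩ := exists_commute_of_mem_closure α ((hmem β).1 hβ)
    have hg : g = 1 := by
      have h1 : b 1 = g * γ 1 := h 1
      simpa using h1.symm
    have h' : ∀ x, b x = γ x := fun x => (h x).trans (by rw [hg, one_mul])
    intro x
    rw [h', h']
    exact DFunLike.congr_fun hγ.eq x
  have htwo : ∀ w : G, α (α w) = w → w = 1 := fun w hw => by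
    refine hfix w ?_
    obtain ⟨k, hk⟩ := hodd
    have h2 : ∀ n : ℕ, ((α ^ 2) ^ n) w = w := fun n => by
      induction n with
      | zero => rfl
      | succ n ih => rw [pow_succ, MulAut.mul_apply, pow_two, MulAut.mul_apply, hw, ← pow_two, ih]
    have h3 : (α ^ p) w = w := by rw [hαp]; rfl
    rwa [hk, pow_succ', pow_mul, MulAut.mul_apply, h2] at h3
  have htriv : ∀ x : G, x = 1 := fun x => by
    have h := (hφ (1, x) (c, 1) (c * c, (α x)⁻¹)).2 (Or.inr ⟨by simp, rfl, by simp⟩)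
    change (φ _, φ _, φ _) ∈ _ at h
    rw [hb1, hb c, hb (c * c)] at h
    rcases h with ⟨h, -, -⟩ | ⟨-, -, h⟩
    · have h' : φ (c, 1) = φ 1 := by
        rw [hb, map_one φ, map_one b]
        exact Prod.ext h.symm rfl
      exact absurd (Prod.mk.inj (φ.injective h')).1 hc1
    · simp only [map_inv, map_one, mul_one, hcomm, mul_inv_eq_one] at h
      exact hbinj ((htwo _ h.symm).trans (map_one b).symm)
  have hα : α = 1 := MulEquiv.ext fun x => (htriv _).trans (htriv _).symm
  rw [hα, orderOf_one] at hord
  exact hp.one_lt.ne hord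
end

section
/- Let G be a transitive permutation group on a finite set Ω, let x ∈ Ω, and let k ≥ 1. If the permutation group induced by the point stabilizer Stab_G(x) on Ω \ {x} is the full automorphism group of some k-ary relational structure with vertex set Ω \ {x}, then G is the full automorphism group of some (k+1)-ary relational structure with vertex set Ω. -/
/-- `σ` is an automorphism of the `k`-ary relational structure `(V, E)`. -/
def IsKaryAut {V : Type*} {k : ℕ} (E : Set (Fin k → V)) (σ : Equiv.Perm V) : Prop :=
  ∀ t : Fin k → V, (fun i => σ (t i)) ∈ E ↔ t ∈ E

/-- The `(k + 1)`-ary relation formed by the `G`-translates of the tuples of `E` prefixed by `x`. -/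
def coneRel {Ω : Type*} (G : Subgroup (Equiv.Perm Ω)) (x : Ω) {k : ℕ}
    (E : Set (Fin k → {y : Ω // y ≠ x})) : Set (Fin (k + 1) → Ω) :=
  {t | ∃ g ∈ G, ∃ e ∈ E, t 0 = g x ∧ ∀ i : Fin k, t i.succ = g (e i)}

theorem mem_coneRel_of_mem {Ω : Type*} {G : Subgroup (Equiv.Perm Ω)} {x : Ω} {k : ℕ}
    {E : Set (Fin k → {y : Ω // y ≠ x})} {g : Equiv.Perm Ω} (hg : g ∈ G)
    {t : Fin (k + 1) → Ω} (ht : t ∈ coneRel G x E) : (fun i => g (t i)) ∈ coneRel G x E := by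
  obtain ⟨h, hh, e, he, h0, hs⟩ := ht
  exact ⟨g * h, mul_mem hg hh, e, he, by simp [h0], fun i => by simp [hs]⟩

theorem isKaryAut_coneRel {Ω : Type*} {G : Subgroup (Equiv.Perm Ω)} {x : Ω} {k : ℕ}
    {E : Set (Fin k → {y : Ω // y ≠ x})} {g : Equiv.Perm Ω} (hg : g ∈ G) :
    IsKaryAut (coneRel G x E) g :=
  fun t => ⟨fun ht => by simpa using mem_coneRel_of_mem (inv_mem hg) ht, mem_coneRel_of_mem hg⟩

theorem IsKaryAut.mul {V : Type*} {k : ℕ} {E : Set (Fin k → V)} {σ τ : Equiv.Perm V}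
    (hσ : IsKaryAut E σ) (hτ : IsKaryAut E τ) : IsKaryAut E (σ * τ) :=
  fun t => (hσ fun i => τ (t i)).trans (hτ t)

/-- The permutation of the complement of a fixed point induced by a permutation. -/
def permCompl {Ω : Type*} {x : Ω} (g : Equiv.Perm Ω) (hg : g x = x) :
    Equiv.Perm {y : Ω // y ≠ x} :=
  g.subtypePerm fun _ => not_congr ⟨fun h => g.injective (h.trans hg.symm), fun h => h ▸ hg⟩

@[simp]
theorem coe_permCompl {Ω : Type*} {x : Ω} (g : Equiv.Perm Ω) (hg : g x = x)
    (y : {y : Ω // y ≠ x}) : (permCompl g hg y : Ω) = g y :=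
  rfl

theorem cons_mem_coneRel_iff {Ω : Type*} {G : Subgroup (Equiv.Perm Ω)} {x : Ω} {k : ℕ}
    {E : Set (Fin k → {y : Ω // y ≠ x})}
    (hE : ∀ g ∈ G, ∀ hg : g x = x, IsKaryAut E (permCompl g hg)) (e : Fin k → {y : Ω // y ≠ x}) :
    (Fin.cons x (fun i => (e i : Ω)) : Fin (k + 1) → Ω) ∈ coneRel G x E ↔ e ∈ E := by
  refine ⟨?_, fun he => ⟨1, one_mem G, e, he, by simp, by simp⟩⟩
  rintro ⟨g, hg, e', he', h0, hs⟩
  have hgx : g x = x := by simpa using h0.symm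
  have : e = fun i => permCompl g hgx (e' i) := by
    funext i
    exact Subtype.ext (by simpa using hs i)
  rw [this]
  exact (hE g hg hgx e').2 he'

theorem statement_2 {Ω : Type*} [Fintype Ω] (G : Subgroup (Equiv.Perm Ω))
    (htrans : ∀ a b : Ω, ∃ g ∈ G, g a = b) (x : Ω) (k : ℕ) (hk : 1 ≤ k)
    (hE : ∃ E : Set (Fin k → {y : Ω // y ≠ x}),
      {σ : Equiv.Perm {y : Ω // y ≠ x} | IsKaryAut E σ} =
        {σ : Equiv.Perm {y : Ω // y ≠ x} |
          ∃ g ∈ G, g x = x ∧ ∀ y : {y : Ω // y ≠ x}, g (y : Ω) = ((σ y : {y : Ω // y ≠ x}) : Ω)}) :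
    ∃ E' : Set (Fin (k + 1) → Ω),
      {σ : Equiv.Perm Ω | IsKaryAut E' σ} = (G : Set (Equiv.Perm Ω)) := by
  obtain ⟨E, hE⟩ := hE
  have hstab : ∀ g ∈ G, ∀ hg : g x = x, IsKaryAut E (permCompl g hg) := fun g hgG hg =>
    (Set.ext_iff.1 hE (permCompl g hg)).2 ⟨g, hgG, hg, fun _ => rfl⟩
  have hfix : ∀ τ : Equiv.Perm Ω, IsKaryAut (coneRel G x E) τ → τ x = x → τ ∈ G := by
    intro τ hτ hx
    have haut : IsKaryAut E (permCompl τ hx) := by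
      intro e
      rw [← cons_mem_coneRel_iff hstab, ← cons_mem_coneRel_iff hstab e,
        ← hτ (Fin.cons x fun i => (e i : Ω))]
      congr! 1
      funext i
      refine Fin.cases ?_ (fun j => ?_) i <;> simp [hx]
    obtain ⟨g, hgG, hgx, hg⟩ := (Set.ext_iff.1 hE (permCompl τ hx)).1 haut
    have : τ = g := by
      ext y
      by_cases hy : y = x
      · rw [hy, hx, hgx]
      · exact (hg ⟨y, hy⟩).symm
    exact this ▸ hgG
  refine ⟨coneRel G x E, Set.Subset.antisymm (fun σ hσ => ?_) fun g hg => isKaryAut_coneRel hg⟩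
  obtain ⟨h, hhG, hh⟩ := htrans (σ x) x
  exact (Subgroup.mul_mem_cancel_left G hhG).1
    (hfix (h * σ) ((isKaryAut_coneRel hhG).mul hσ) hh)
end

section
/- Let m ≥ 2 and s ≥ 1 be integers, and let ρ be a permutation of a set Ω of size ms that is semiregular of order m with s orbits (that is, ρ has order m and the cyclic group ⟨ρ⟩ acts freely on Ω, so that ⟨ρ⟩ has exactly s orbits, each of size m). Then there exists a digraph with vertex set Ω whose full automorphism group is exactly the cyclic group ⟨ρ⟩. -/
/-- `σ` is an automorphism of the digraph (binary relational structure) `(V, E)`. -/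
def IsDigraphAut {V : Type*} (E : Set (V × V)) (σ : Equiv.Perm V) : Prop :=
  ∀ u v : V, (σ u, σ v) ∈ E ↔ (u, v) ∈ E

/-- Directed cycles along `ρ`, together with the translates under `ρ` of the transitive tournament
on the points `b i`. -/
def cycleTournament {V : Type*} {n : ℕ} (ρ : Equiv.Perm V) (b : Fin n → V) : Set (V × V) :=
  {p | p.2 = ρ p.1 ∨ ∃ i j : Fin n, i < j ∧ ∃ k : ℤ, p.1 = (ρ ^ k) (b i) ∧ p.2 = (ρ ^ k) (b j)}

theorem isDigraphAut_cycleTournament_zpow {V : Type*} {n : ℕ} (ρ : Equiv.Perm V) (b : Fin n → V)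
    (l : ℤ) : IsDigraphAut (cycleTournament ρ b) (ρ ^ l) := by
  have key : ∀ (l : ℤ) (u v : V), (u, v) ∈ cycleTournament ρ b →
      ((ρ ^ l) u, (ρ ^ l) v) ∈ cycleTournament ρ b := by
    rintro l u v (h | ⟨i, j, hij, k, hu, hv⟩)
    · refine Or.inl ?_
      simp only at h ⊢
      rw [h, ← Equiv.Perm.mul_apply, ← Equiv.Perm.mul_apply, ← zpow_add_one, ← zpow_one_add,
        add_comm]
    · refine Or.inr ⟨i, j, hij, l + k, ?_, ?_⟩
      · simp only at hu ⊢
        rw [hu, zpow_add, Equiv.Perm.mul_apply]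
      · simp only at hv ⊢
        rw [hv, zpow_add, Equiv.Perm.mul_apply]
  intro u v
  refine ⟨fun h => ?_, key l u v⟩
  simpa using key (-l) _ _ h

theorem ncard_inNeighbors_cycleTournament {V : Type*} {n : ℕ} {ρ : Equiv.Perm V} {b : Fin n → V}
    {idx : V → Fin n} (hidx : ∀ u v, idx u = idx v ↔ ρ.SameCycle u v) (hb : ∀ i, idx (b i) = i)
    (hfree : ∀ (k l : ℤ) (ω : V), (ρ ^ k) ω = (ρ ^ l) ω → ρ ^ k = ρ ^ l) (v : V) :
    {u | (u, v) ∈ cycleTournament ρ b}.ncard = idx v + 1 := by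
  have hpow : ∀ (k : ℤ) (i : Fin n), idx ((ρ ^ k) (b i)) = i := fun k i => by
    rw [(hidx _ _).2 (Equiv.Perm.sameCycle_zpow_left.2 (Equiv.Perm.SameCycle.refl ρ _)), hb i]
  have hρ : ∀ u, idx (ρ u) = idx u := fun u =>
    (hidx _ _).2 (Equiv.Perm.sameCycle_apply_left.2 (Equiv.Perm.SameCycle.refl ρ _))
  obtain ⟨l, hl⟩ := (hidx _ _).1 (hb (idx v))
  have hIic : ((Finset.Iic (idx v) : Finset (Fin n)) : Set (Fin n)).ncard = idx v + 1 := by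
    rw [Set.ncard_coe_finset, Fin.card_Iic]
  rw [← hIic]
  refine Set.ncard_congr (fun u _ => idx u) ?_ ?_ ?_
  · rintro u (h | ⟨i, j, hij, k, hu, hv⟩)
    · simp only at h
      simp [h, hρ]
    · simp only at hu hv
      simp [hu, hv, hpow, hij.le]
  · rintro u w (h | ⟨i, j, hij, k, hu, hv⟩) (h' | ⟨i', j', hij', k', hu', hv'⟩) huw
    · simp only at h h'
      exact ρ.injective (h.symm.trans h')
    · simp only at h hu' hv' huw
      rw [← hρ, ← h, hu', hv', hpow, hpow] at huw
      exact absurd huw hij'.ne'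
    · simp only at h' hu hv huw
      rw [← hρ w, ← h', hu, hv, hpow, hpow] at huw
      exact absurd huw hij.ne
    · simp only at hu hv hu' hv' huw
      have hj : j = j' := by rw [← hpow k j, ← hpow k' j', ← hv, ← hv']
      have hi : i = i' := by rw [← hpow k i, ← hpow k' i', ← hu, ← hu', huw]
      subst hj hi
      rw [hu, hu', hfree k k' (b j) (hv.symm.trans hv')]
  · intro i hi
    simp only [Finset.coe_Iic, Set.mem_Iic] at hi
    rcases hi.lt_or_eq with hi | rfl
    · exact ⟨(ρ ^ l) (b i), Or.inr ⟨i, idx v, hi, l, rfl, hl.symm⟩, hpow l i⟩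
    · refine ⟨ρ⁻¹ v, Or.inl (by simp), ?_⟩
      rw [← hρ]
      simp

theorem mem_zpowers_of_isDigraphAut_cycleTournament {V : Type*} [Nonempty V] {n : ℕ}
    {ρ : Equiv.Perm V} {b : Fin n → V}
    {idx : V → Fin n} (hidx : ∀ u v, idx u = idx v ↔ ρ.SameCycle u v) (hb : ∀ i, idx (b i) = i)
    (hfree : ∀ (k l : ℤ) (ω : V), (ρ ^ k) ω = (ρ ^ l) ω → ρ ^ k = ρ ^ l)
    {σ : Equiv.Perm V} (hσ : IsDigraphAut (cycleTournament ρ b) σ) :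
    σ ∈ Subgroup.zpowers ρ := by
  have hpow : ∀ (k : ℤ) (i : Fin n), idx ((ρ ^ k) (b i)) = i := fun k i => by
    rw [(hidx _ _).2 (Equiv.Perm.sameCycle_zpow_left.2 (Equiv.Perm.SameCycle.refl ρ _)), hb i]
  have hρ : ∀ u, idx (ρ u) = idx u := fun u =>
    (hidx _ _).2 (Equiv.Perm.sameCycle_apply_left.2 (Equiv.Perm.SameCycle.refl ρ _))
  have hσidx : ∀ v, idx (σ v) = idx v := fun v => by
    have himg : {u | (u, σ v) ∈ cycleTournament ρ b} =
        σ '' {u | (u, v) ∈ cycleTournament ρ b} := by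
      ext u
      rw [Equiv.image_eq_preimage_symm]
      simpa using hσ (σ.symm u) v
    have hc := congrArg Set.ncard himg
    rw [Set.ncard_image_of_injective _ σ.injective,
      ncard_inNeighbors_cycleTournament hidx hb hfree,
      ncard_inNeighbors_cycleTournament hidx hb hfree] at hc
    exact Fin.ext (by omega)
  have hcomm : Commute σ ρ := by
    ext u
    rcases (hσ u (ρ u)).2 (Or.inl rfl) with h | ⟨i, j, hij, k, hu, hv⟩
    · exact h
    · simp only at hu hv
      have h : idx (σ u) = idx (σ (ρ u)) := by rw [hσidx, hσidx, hρ]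
      rw [hu, hv, hpow, hpow] at h
      exact absurd h hij.ne
  have hlt : ∀ i j : Fin n, i < j → ∃ k : ℤ, σ (b i) = (ρ ^ k) (b i) ∧ σ (b j) = (ρ ^ k) (b j) := by
    intro i j hij
    rcases (hσ (b i) (b j)).2 (Or.inr ⟨i, j, hij, 0, by simp, by simp⟩) with
      h | ⟨i', j', _, k, hu, hv⟩
    · simp only at h
      have h' := congrArg idx h
      rw [hρ, hσidx, hσidx, hb, hb] at h'
      exact absurd h' hij.ne'
    · simp only at hu hv
      have hi := congrArg idx hu
      have hj := congrArg idx hv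
      rw [hσidx, hpow, hb] at hi hj
      subst hi hj
      exact ⟨k, hu, hv⟩
  obtain ⟨w⟩ := ‹Nonempty V›
  obtain ⟨a, ha⟩ : ρ.SameCycle (b (idx w)) (σ (b (idx w))) := (hidx _ _).1 (hσidx _).symm
  have hbase : ∀ i, σ (b i) = (ρ ^ a) (b i) := by
    intro i
    rcases lt_trichotomy i (idx w) with h | h | h
    · obtain ⟨k, h1, h2⟩ := hlt _ _ h
      rw [h1, hfree k a _ (h2.symm.trans ha.symm)]
    · rw [h, ha]
    · obtain ⟨k, h1, h2⟩ := hlt _ _ h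
      rw [h2, hfree k a _ (h1.symm.trans ha.symm)]
  refine ⟨a, ?_⟩
  ext u
  obtain ⟨l, hl⟩ := (hidx _ _).1 (hb (idx u))
  have h := congrArg (fun τ : Equiv.Perm V => τ (b (idx u))) (hcomm.zpow_right l).eq
  simp only [Equiv.Perm.mul_apply, hl, hbase] at h
  rw [h, ← Equiv.Perm.mul_apply, ← zpow_add, add_comm, zpow_add, Equiv.Perm.mul_apply, hl]

theorem statement_3 {Ω : Type*} [Fintype Ω] (m s : ℕ) (hm : 2 ≤ m) (hs : 1 ≤ s)
    (hcard : Fintype.card Ω = m * s) (ρ : Equiv.Perm Ω) (hord : orderOf ρ = m)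
    (hsemi : ∀ g ∈ Subgroup.zpowers ρ, ∀ ω : Ω, g ω = ω → g = 1) :
    ∃ E : Set (Ω × Ω),
      {σ : Equiv.Perm Ω | IsDigraphAut E σ} =
        (Subgroup.zpowers ρ : Set (Equiv.Perm Ω)) := by
  have : Nonempty Ω := by
    rw [← Fintype.card_pos_iff, hcard]
    positivity
  let S := Equiv.Perm.SameCycle.setoid ρ
  let e := Finite.equivFin (Quotient S)
  let b : Fin (Nat.card (Quotient S)) → Ω := fun i => (e.symm i).out
  let idx : Ω → Fin (Nat.card (Quotient S)) := fun u => e (Quotient.mk S u)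
  have hidx : ∀ u v, idx u = idx v ↔ ρ.SameCycle u v := fun u v =>
    e.injective.eq_iff.trans Quotient.eq
  have hb : ∀ i, idx (b i) = i := fun i => by simp [idx, b]
  have hfree : ∀ (k l : ℤ) (ω : Ω), (ρ ^ k) ω = (ρ ^ l) ω → ρ ^ k = ρ ^ l := by
    intro k l ω h
    have h1 : ((ρ ^ l)⁻¹ * ρ ^ k) = 1 := by
      refine hsemi _ (mul_mem (inv_mem ⟨l, rfl⟩) ⟨k, rfl⟩) ω ?_
      rw [Equiv.Perm.mul_apply, h, ← Equiv.Perm.mul_apply, inv_mul_cancel, Equiv.Perm.one_apply]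
    exact (inv_mul_eq_one.1 h1).symm
  refine ⟨cycleTournament ρ b, Set.ext fun σ => ⟨fun hσ => ?_, ?_⟩⟩
  · exact mem_zpowers_of_isDigraphAut_cycleTournament hidx hb hfree hσ
  · rintro ⟨l, rfl⟩
    exact isDigraphAut_cycleTournament_zpow ρ b l
end

section
/- The group ℤ_3 × ℤ_2², the direct product of the cyclic group of order 3 with the elementary abelian group of order 4, is not a CI-group with respect to ternary relational structures. -/
/-- Multiplication by a primitive cube root of unity `ω` on `ZMod 2 × ZMod 2`, seen as the field
with four elements. -/
def omegaMul : ZMod 2 × ZMod 2 →+ ZMod 2 × ZMod 2 where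
  toFun x := (x.2, x.1 + x.2)
  map_zero' := rfl
  map_add' := by decide

/-- Triples `((i, x), (i, y), (i, z))` with `z - x = ω (y - x)`, together with triples
`((i, x), (i + 1, y), (i + 2, z))` with `x + S y + S (S z) = 0`. -/
def cubeRootRelation (S : ZMod 2 × ZMod 2 →+ ZMod 2 × ZMod 2)
    (u v w : ZMod 3 × (ZMod 2 × ZMod 2)) : Prop :=
  (v.1 = u.1 ∧ w.1 = u.1 ∧ w.2 - u.2 = omegaMul (v.2 - u.2)) ∨
    (v.1 = u.1 + 1 ∧ w.1 = u.1 + 2 ∧ u.2 + S v.2 + S (S w.2) = 0)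

instance (S : ZMod 2 × ZMod 2 →+ ZMod 2 × ZMod 2) (u v w : ZMod 3 × (ZMod 2 × ZMod 2)) :
    Decidable (cubeRootRelation S u v w) := by
  unfold cubeRootRelation; infer_instance

theorem cubeRootRelation_add_left {S : ZMod 2 × ZMod 2 →+ ZMod 2 × ZMod 2}
    (hS : ∀ x, x + S x + S (S x) = 0) (g u v w : ZMod 3 × (ZMod 2 × ZMod 2)) :
    cubeRootRelation S (g + u) (g + v) (g + w) ↔ cubeRootRelation S u v w := by
  have h : g.2 + u.2 + (S g.2 + S v.2) + (S (S g.2) + S (S w.2)) =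
      u.2 + S v.2 + S (S w.2) := by
    rw [← zero_add (u.2 + S v.2 + S (S w.2)), ← hS g.2]
    abel
  simp only [cubeRootRelation, Prod.fst_add, Prod.snd_add, add_sub_add_left_eq_sub, map_add, h,
    add_assoc g.1, add_right_inj]

/-- The ternary structure on the multiplicative group given by `cubeRootRelation S`. -/
def cubeRootStructure (S : ZMod 2 × ZMod 2 →+ ZMod 2 × ZMod 2) :
    Set (Multiplicative (ZMod 3 × (ZMod 2 × ZMod 2)) ×
      Multiplicative (ZMod 3 × (ZMod 2 × ZMod 2)) ×
      Multiplicative (ZMod 3 × (ZMod 2 × ZMod 2))) :=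
  {t | cubeRootRelation S t.1.toAdd t.2.1.toAdd t.2.2.toAdd}

theorem isCayleyTernary_cubeRootStructure {S : ZMod 2 × ZMod 2 →+ ZMod 2 × ZMod 2}
    (hS : ∀ x, x + S x + S (S x) = 0) : IsCayleyTernary _ (cubeRootStructure S) :=
  fun g u v w => cubeRootRelation_add_left hS g.toAdd u.toAdd v.toAdd w.toAdd

/-- The permutation `(i, x) ↦ (i, ω⁻ⁱ x)`. -/
def twist : Equiv.Perm (ZMod 3 × (ZMod 2 × ZMod 2)) where
  toFun u := (u.1, omegaMul^[(-u.1).val] u.2)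
  invFun u := (u.1, omegaMul^[u.1.val] u.2)
  left_inv := by decide
  right_inv := by decide

theorem cubeRootRelation_twist (u v w : ZMod 3 × (ZMod 2 × ZMod 2)) :
    cubeRootRelation (omegaMul.comp omegaMul) (twist u) (twist v) (twist w) ↔
      cubeRootRelation omegaMul u v w := by
  obtain ⟨i, x⟩ := u
  obtain ⟨j, y⟩ := v
  obtain ⟨k, z⟩ := w
  have same : ∀ (i : ZMod 3) (x y z : ZMod 2 × ZMod 2),
      omegaMul^[(-i).val] z - omegaMul^[(-i).val] x =
        omegaMul (omegaMul^[(-i).val] y - omegaMul^[(-i).val] x) ↔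
      z - x = omegaMul (y - x) := by decide
  have cyclic : ∀ (i : ZMod 3) (x y z : ZMod 2 × ZMod 2),
      omegaMul^[(-i).val] x + omegaMul (omegaMul (omegaMul^[(-(i + 1)).val] y)) +
        omegaMul (omegaMul (omegaMul (omegaMul (omegaMul^[(-(i + 2)).val] z)))) = 0 ↔
      x + omegaMul y + omegaMul (omegaMul z) = 0 := by decide
  refine or_congr (and_congr_right ?_) (and_congr_right ?_)
  · rintro (rfl : j = i)
    refine and_congr_right ?_
    rintro (rfl : k = j)
    exact same k x y z
  · rintro (rfl : j = i + 1)
    refine and_congr_right ?_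
    rintro (rfl : k = i + 2)
    exact cyclic i x y z

/-- No images `p`, `q`, `r` of the generators `(0, (1, 0))`, `(0, (0, 1))`, `(1, 0)` under an
automorphism are compatible with `cubeRootRelation (ω²)` on three triples of
`cubeRootRelation ω`. -/
theorem not_cubeRootRelation_images : ∀ p : ZMod 3 × (ZMod 2 × ZMod 2), p + p = 0 → p ≠ 0 →
    ∀ q, cubeRootRelation (omegaMul.comp omegaMul) 0 p q → ∀ r, r + r + r = 0 → r ≠ 0 →
      cubeRootRelation (omegaMul.comp omegaMul) 0 r (r + r) →
      ¬ cubeRootRelation (omegaMul.comp omegaMul) 0 (r + q) (r + r + p) := by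
  decide

theorem statement_4 :
    ¬ IsCIGroupTernary (Multiplicative (ZMod 3 × (ZMod 2 × ZMod 2))) := by
  intro hCI
  obtain ⟨φ, hφ⟩ := hCI (cubeRootStructure omegaMul)
    (cubeRootStructure (omegaMul.comp omegaMul))
    (isCayleyTernary_cubeRootStructure (by decide))
    (isCayleyTernary_cubeRootStructure (by decide))
    ⟨twist, cubeRootRelation_twist⟩
  let f : ZMod 3 × (ZMod 2 × ZMod 2) ≃+ ZMod 3 × (ZMod 2 × ZMod 2) :=
    MulEquiv.toAdditive φ
  have hf (u v w) (h : cubeRootRelation omegaMul u v w) :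
      cubeRootRelation (omegaMul.comp omegaMul) (f u) (f v) (f w) := (hφ u v w).2 h
  have h₁ := hf 0 (0, (1, 0)) (0, (0, 1)) (by decide)
  have h₂ := hf 0 (1, 0) ((1, 0) + (1, 0)) (by decide)
  have h₃ := hf 0 ((1, 0) + (0, (0, 1))) ((1, 0) + (1, 0) + (0, (1, 0))) (by decide)
  simp only [map_zero, map_add] at h₁ h₂ h₃
  refine not_cubeRootRelation_images _ ?_ ?_ _ h₁ _ ?_ ?_ h₂ h₃
  · rw [← map_add, show ((0, (1, 0)) + (0, (1, 0)) : ZMod 3 × (ZMod 2 × ZMod 2)) = 0 by decide,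
      map_zero]
  · exact (map_ne_zero_iff f f.injective).2 (by decide)
  · rw [← map_add, ← map_add,
      show ((1, 0) + (1, 0) + (1, 0) : ZMod 3 × (ZMod 2 × ZMod 2)) = 0 by decide, map_zero]
  · exact (map_ne_zero_iff f f.injective).2 (by decide)
end

section
/- The group ℤ_7 × ℤ_2³, the direct product of the cyclic group of order 7 with the elementary abelian group of order 8, is not a CI-group with respect to ternary relational structures. -/
namespace TernaryCounterexample

/-- Multiplication by a root `t` of `X ^ 3 + X + 1` on `𝔽₈`, in the basis `1, t, t ^ 2`. -/
def mulRoot : AddAut (ZMod 2 × ZMod 2 × ZMod 2) where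
  toFun v := (v.2.2, v.1 + v.2.2, v.2.1)
  invFun v := (v.2.1 + v.1, v.2.2, v.1)
  left_inv := by decide
  right_inv := by decide
  map_add' := by decide

theorem seven_nsmul_mulRoot : 7 • mulRoot = 0 := by
  ext1 v
  revert v
  decide

theorem mulRoot_cube (v : ZMod 2 × ZMod 2 × ZMod 2) :
    mulRoot (mulRoot (mulRoot v)) = mulRoot v + v := by
  revert v
  decide

theorem val_add_nsmul_mulRoot (a b : ZMod 7) :
    (a + b).val • mulRoot = a.val • mulRoot + b.val • mulRoot := by
  rw [ZMod.val_add, ← nsmul_eq_mod_nsmul _ seven_nsmul_mulRoot, add_nsmul]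

/-- The permutation `(a, v) ↦ (a, t ^ a v)` of `ℤ₇ × 𝔽₈`. -/
def twist : Equiv.Perm (Multiplicative (ZMod 7 × (ZMod 2 × ZMod 2 × ZMod 2))) where
  toFun x := .ofAdd (x.toAdd.1, (x.toAdd.1.val • mulRoot) x.toAdd.2)
  invFun x := .ofAdd (x.toAdd.1, (-(x.toAdd.1.val • mulRoot)) x.toAdd.2)
  left_inv x := by simp
  right_inv x := by simp

/-- The triples `(a, u), (a + 1, v), (a + 2, w)` with `t w = u + t ^ 3 v`. -/
def sourceRel : Set (Multiplicative (ZMod 7 × (ZMod 2 × ZMod 2 × ZMod 2)) ×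
    Multiplicative (ZMod 7 × (ZMod 2 × ZMod 2 × ZMod 2)) ×
    Multiplicative (ZMod 7 × (ZMod 2 × ZMod 2 × ZMod 2))) :=
  {p | p.2.1.toAdd.1 = p.1.toAdd.1 + 1 ∧ p.2.2.toAdd.1 = p.1.toAdd.1 + 2 ∧
    mulRoot p.2.2.toAdd.2 = p.1.toAdd.2 + mulRoot (mulRoot (mulRoot p.2.1.toAdd.2))}

/-- The triples `(a, u), (a + 1, v), (a + 2, w)` with `w = t u + t ^ 3 v`. -/
def targetRel : Set (Multiplicative (ZMod 7 × (ZMod 2 × ZMod 2 × ZMod 2)) ×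
    Multiplicative (ZMod 7 × (ZMod 2 × ZMod 2 × ZMod 2)) ×
    Multiplicative (ZMod 7 × (ZMod 2 × ZMod 2 × ZMod 2))) :=
  {p | p.2.1.toAdd.1 = p.1.toAdd.1 + 1 ∧ p.2.2.toAdd.1 = p.1.toAdd.1 + 2 ∧
    p.2.2.toAdd.2 = mulRoot p.1.toAdd.2 + mulRoot (mulRoot (mulRoot p.2.1.toAdd.2))}

theorem isCayleyTernary_sourceRel : IsCayleyTernary _ sourceRel := by
  intro g x y z
  have h (c : ZMod 2 × ZMod 2 × ZMod 2) :
      mulRoot c = c + mulRoot (mulRoot (mulRoot c)) := by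
    revert c
    decide
  simp only [sourceRel, Set.mem_ofPred_eq, Equiv.coe_mulLeft, toAdd_mul, Prod.fst_add,
    Prod.snd_add, map_add, add_assoc, add_right_inj]
  refine and_congr_right' (and_congr_right' ?_)
  nth_rw 1 [h g.toAdd.2]
  rw [add_assoc, add_right_inj, add_left_comm, add_right_inj]

theorem isCayleyTernary_targetRel : IsCayleyTernary _ targetRel := by
  intro g x y z
  have h (c : ZMod 2 × ZMod 2 × ZMod 2) :
      c = mulRoot c + mulRoot (mulRoot (mulRoot c)) := by
    revert c
    decide
  simp only [targetRel, Set.mem_ofPred_eq, Equiv.coe_mulLeft, toAdd_mul, Prod.fst_add,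
    Prod.snd_add, map_add, add_assoc, add_right_inj]
  refine and_congr_right' (and_congr_right' ?_)
  nth_rw 1 [h g.toAdd.2]
  rw [add_assoc, add_right_inj, add_left_comm, add_right_inj]

theorem isTernaryIso_twist : IsTernaryIso twist sourceRel targetRel := by
  intro x y z
  simp only [sourceRel, targetRel, twist, Set.mem_ofPred_eq, Equiv.coe_fn_mk, toAdd_ofAdd]
  refine and_congr_right fun hy => and_congr_right fun hz => ?_
  have hcomm (n : ℕ) (v : ZMod 2 × ZMod 2 × ZMod 2) :
      (n • mulRoot) (mulRoot v) = mulRoot ((n • mulRoot) v) := by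
    rw [← AddAut.add_apply, ← AddAut.add_apply, ← succ_nsmul, ← succ_nsmul']
  have h1 : (1 : ZMod 7).val • mulRoot = mulRoot := one_nsmul _
  have h2 : (2 : ZMod 7).val • mulRoot = mulRoot + mulRoot := two_nsmul _
  rw [hy, hz, val_add_nsmul_mulRoot, val_add_nsmul_mulRoot, h1, h2]
  simp only [AddAut.add_apply, hcomm]
  simp only [← map_add, ← hcomm, EmbeddingLike.apply_eq_iff_eq]

theorem not_isTernaryIso_mulEquiv
    (φ : Multiplicative (ZMod 7 × (ZMod 2 × ZMod 2 × ZMod 2)) ≃*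
      Multiplicative (ZMod 7 × (ZMod 2 × ZMod 2 × ZMod 2))) :
    ¬ IsTernaryIso φ.toEquiv sourceRel targetRel := by
  intro hφ
  let ψ : (ZMod 7 × (ZMod 2 × ZMod 2 × ZMod 2)) ≃+ (ZMod 7 × (ZMod 2 × ZMod 2 × ZMod 2)) :=
    MulEquiv.toAdditive φ
  let B (v : ZMod 2 × ZMod 2 × ZMod 2) : ZMod 2 × ZMod 2 × ZMod 2 := (ψ (0, v)).2
  have hfst (v : ZMod 2 × ZMod 2 × ZMod 2) : (ψ (0, v)).1 = 0 := by
    have h : 2 • ψ (0, v) = 0 := by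
      rw [← map_nsmul, show 2 • ((0 : ZMod 7), v) = 0 by revert v; decide, map_zero]
    have h' : 2 • (ψ (0, v)).1 = 0 := congrArg Prod.fst h
    revert h'
    generalize (ψ (0, v)).1 = a
    revert a
    decide
  have hsnd (a : ZMod 7) : (ψ (a, 0)).2 = 0 := by
    have h : 7 • ψ (a, 0) = 0 := by
      rw [← map_nsmul, show 7 • (a, (0 : ZMod 2 × ZMod 2 × ZMod 2)) = 0 by revert a; decide,
        map_zero]
    have h' : 7 • (ψ (a, 0)).2 = 0 := congrArg Prod.snd h
    revert h'
    generalize (ψ (a, 0)).2 = v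
    revert v
    decide
  have hadd (u v : ZMod 2 × ZMod 2 × ZMod 2) : B (u + v) = B u + B v := by
    have h := map_add ψ (0, u) (0, v)
    rw [Prod.mk_add_mk, add_zero] at h
    exact congrArg Prod.snd h
  have hB (v : ZMod 2 × ZMod 2 × ZMod 2) : B v = mulRoot (B (mulRoot v)) := by
    have h := ((hφ (.ofAdd (0, mulRoot v)) (.ofAdd (1, 0)) (.ofAdd (2, v))).mpr (by
      simp [sourceRel])).2.2
    change (ψ (2, v)).2 = mulRoot (ψ (0, mulRoot v)).2 +
      mulRoot (mulRoot (mulRoot (ψ (1, 0)).2)) at h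
    have h2 : ψ (2, v) = ψ (2, 0) + ψ (0, v) := by
      rw [← map_add, Prod.mk_add_mk, add_zero, zero_add]
    rw [h2, Prod.snd_add, hsnd, hsnd, map_zero, map_zero, map_zero, zero_add, add_zero] at h
    exact h
  have hzero (v : ZMod 2 × ZMod 2 × ZMod 2) : B v = 0 := by
    have h : B v = mulRoot (mulRoot (mulRoot (B (mulRoot v) + B v))) := by
      rw [← hadd, ← mulRoot_cube, ← hB, ← hB, ← hB]
    rw [map_add, ← hB] at h
    revert h
    generalize B v = y
    revert y
    decide
  have h : ψ (0, (1, 0, 0)) = ψ 0 := by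
    rw [map_zero]
    exact Prod.ext (hfst _) (hzero _)
  exact absurd (ψ.injective h) (by decide)

end TernaryCounterexample

open TernaryCounterexample

theorem statement_5 :
    ¬ IsCIGroupTernary (Multiplicative (ZMod 7 × (ZMod 2 × ZMod 2 × ZMod 2))) := by
  intro h
  obtain ⟨φ, hφ⟩ := h sourceRel targetRel isCayleyTernary_sourceRel isCayleyTernary_targetRel
    ⟨twist, isTernaryIso_twist⟩
  exact not_isTernaryIso_mulEquiv φ hφ
end

section
/- The group ℤ_5 × ℤ_2⁴, the direct product of the cyclic group of order 5 with the elementary abelian group of order 16, is not a CI-group with respect to ternary relational structures. -/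
section FibredAffine

variable {n : ℕ} {A H : Type*} [AddCommGroup A] [Group H] [DistribMulAction H A]

/-- The triples of `ℤ_n × A` that either lie in one fibre over `ℤ_n` and satisfy
`y - x = a • (z - x)`, or lie in three consecutive fibres and satisfy `z - y = b • (y - x)`. -/
def fibredAffineTriples (n : ℕ) (A : Type*) [AddCommGroup A] [DistribMulAction H A] (a b : H) :
    Set (Multiplicative (ZMod n × A) × Multiplicative (ZMod n × A) ×
      Multiplicative (ZMod n × A)) :=
  {t | (t.2.1.toAdd.1 = t.1.toAdd.1 ∧ t.2.2.toAdd.1 = t.1.toAdd.1 ∧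
        t.2.1.toAdd.2 - t.1.toAdd.2 = a • (t.2.2.toAdd.2 - t.1.toAdd.2)) ∨
      (t.2.1.toAdd.1 = t.1.toAdd.1 + 1 ∧ t.2.2.toAdd.1 = t.2.1.toAdd.1 + 1 ∧
        t.2.2.toAdd.2 - t.2.1.toAdd.2 = b • (t.2.1.toAdd.2 - t.1.toAdd.2))}

theorem isCayleyTernary_fibredAffineTriples (a b : H) :
    IsCayleyTernary (Multiplicative (ZMod n × A)) (fibredAffineTriples n A a b) := by
  rintro g u v w
  simp only [fibredAffineTriples, Set.mem_ofPred_eq, Equiv.coe_mulLeft, toAdd_mul, Prod.fst_add,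
    Prod.snd_add, add_sub_add_left_eq_sub, add_assoc, add_right_inj]

theorem pow_zmod_val_add_one [NeZero n] {a : H} (ha : a ^ n = 1) (i : ZMod n) :
    a ^ (i + 1).val = a ^ i.val * a := by
  rw [ZMod.val_add, ← pow_eq_pow_mod _ ha, pow_add, ZMod.val_one_eq_one_mod,
    ← pow_eq_pow_mod _ ha, pow_one]

/-- The permutation of `ℤ_n × A` acting on the fibre over `i` as `a ^ i`. -/
def fibrePow (n : ℕ) (A : Type*) [AddCommGroup A] [DistribMulAction H A] (a : H) :
    Equiv.Perm (Multiplicative (ZMod n × A)) :=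
  (Multiplicative.toAdd.trans
    (Equiv.prodShear (Equiv.refl (ZMod n)) fun i => MulAction.toPerm (a ^ i.val))).trans
    Multiplicative.ofAdd

theorem isTernaryIso_fibrePow [NeZero n] {a : H} (ha : a ^ n = 1) :
    IsTernaryIso (fibrePow n A a) (fibredAffineTriples n A a a⁻¹)
      (fibredAffineTriples n A a a) := by
  rintro ⟨i, x⟩ ⟨j, y⟩ ⟨k, z⟩
  refine or_congr (and_congr_right ?_) (and_congr_right ?_)
  · rintro (rfl : j = i)
    refine and_congr_right ?_
    rintro (rfl : k = j)
    change a ^ k.val • y - a ^ k.val • x = a • (a ^ k.val • z - a ^ k.val • x) ↔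
      y - x = a • (z - x)
    rw [← smul_sub, ← smul_sub, smul_smul, ← pow_succ', pow_succ, mul_smul, smul_left_cancel_iff]
  · rintro (rfl : j = i + 1)
    refine and_congr_right ?_
    rintro (rfl : k = i + 1 + 1)
    change a ^ (i + 1 + 1).val • z - a ^ (i + 1).val • y =
      a • (a ^ (i + 1).val • y - a ^ i.val • x) ↔ z - y = a⁻¹ • (y - x)
    simp only [pow_zmod_val_add_one ha, mul_smul]
    rw [← smul_sub, ← smul_sub, ← smul_sub, smul_smul a, ← pow_succ', pow_succ, mul_smul,
      smul_left_cancel_iff, smul_left_cancel_iff, eq_inv_smul_iff, smul_sub a z y,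
      sub_eq_sub_iff_add_eq_add, sub_eq_sub_iff_add_eq_add, add_comm y]

theorem not_isCIGroupTernary [NeZero n] (hn : Odd n) (hA : ∀ x : A, x + x = 0) {a : H}
    (ha : a ^ n = 1) {x : A} (hx : a • a • x ≠ x) :
    ¬ IsCIGroupTernary (Multiplicative (ZMod n × A)) := by
  intro hCI
  obtain ⟨φ, hφ⟩ := hCI _ _ (isCayleyTernary_fibredAffineTriples a a⁻¹)
    (isCayleyTernary_fibredAffineTriples a a) ⟨_, isTernaryIso_fibrePow ha⟩
  obtain ⟨f, rfl⟩ : ∃ f : (ZMod n × A) ≃+ (ZMod n × A), f.toMultiplicative = φ :=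
    ⟨AddEquiv.toMultiplicative.symm φ, Equiv.apply_symm_apply _ φ⟩
  have hf (i j k : ZMod n) (x y z : A) := hφ (.ofAdd (i, x)) (.ofAdd (j, y)) (.ofAdd (k, z))
  change ∀ i j k : ZMod n, ∀ x y z : A,
    (((f (j, y)).1 = (f (i, x)).1 ∧ (f (k, z)).1 = (f (i, x)).1 ∧
        (f (j, y)).2 - (f (i, x)).2 = a • ((f (k, z)).2 - (f (i, x)).2)) ∨
      ((f (j, y)).1 = (f (i, x)).1 + 1 ∧ (f (k, z)).1 = (f (j, y)).1 + 1 ∧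
        (f (k, z)).2 - (f (j, y)).2 = a • ((f (j, y)).2 - (f (i, x)).2))) ↔
    ((j = i ∧ k = i ∧ y - x = a • (z - x)) ∨ (j = i + 1 ∧ k = j + 1 ∧ z - y = a⁻¹ • (y - x))) at hf
  have two_torsion {r : ZMod n} (hr : r + r = 0) : r = 0 := by
    obtain ⟨k, rfl⟩ := hn
    have h := CharP.cast_eq_zero (ZMod (2 * k + 1)) (2 * k + 1)
    push_cast at h
    linear_combination r * h - k * hr
  have hone : (1 : ZMod n) ≠ 0 := by
    intro h
    have : n = 1 := by
      have := (ZMod.natCast_eq_zero_iff 1 n).1 (by simpa using h)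
      simpa using this
    subst this
    simp_all
  have hfst (y : A) : (f (0, y)).1 = 0 := by
    apply two_torsion
    rw [← Prod.fst_add, ← map_add, Prod.mk_add_mk, hA, add_zero]
    exact congrArg Prod.fst f.map_zero
  have hzero : f (0, 0) = 0 := f.map_zero
  have hsmul (y : A) : (f (0, a • y)).2 = a • (f (0, y)).2 := by
    have h := (hf 0 0 0 0 (a • y) y).2 (Or.inl (by simp))
    simpa [hfst, hzero, hone.symm] using h
  have hc : (f (1, 0)).1 ≠ 0 := by
    intro h
    have h2 : f (1 + 1, 0) = 0 := by
      have : f (1 + 1, 0) = f (1, 0) + f (1, 0) := by rw [← map_add]; simp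
      rw [this]
      ext <;> simp [h, hA]
    have h3 : ((1 + 1, 0) : ZMod n × A) = 0 := f.map_eq_zero_iff.1 h2
    exact hone (two_torsion (congrArg Prod.fst h3))
  have hone_add (y : A) : f (1, y) = f (1, 0) + f (0, y) := by rw [← map_add]; simp
  have htwo_add (y : A) : f (1 + 1, y) = f (1, 0) + f (1, 0) + f (0, y) := by
    rw [← map_add, ← map_add]; simp
  have hrec (y : A) : (f (1, 0)).2 + (f (0, a⁻¹ • y)).2 = a • ((f (1, 0)).2 + (f (0, y)).2) := by
    have h := (hf 0 1 (1 + 1) 0 y (y + a⁻¹ • y)).2 (Or.inr (by simp))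
    have hadd : f (0, y + a⁻¹ • y) = f (0, y) + f (0, a⁻¹ • y) := by rw [← map_add]; simp
    rw [htwo_add, hone_add, hadd, hzero] at h
    rcases h with h | h
    · exact absurd (by simpa [hfst] using h.1) hc
    · have := h.2.2
      simp only [Prod.snd_add, Prod.snd_zero, sub_zero] at this
      rw [← this]
      abel
  have hinv : (f (0, a⁻¹ • a • x)).2 = a • (f (0, a • x)).2 := by
    have h0 := hrec 0
    simp only [smul_zero, hzero, Prod.snd_zero, add_zero] at h0
    have h := hrec (a • x)
    rwa [smul_add, ← h0, add_right_inj] at h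
  rw [inv_smul_smul, ← hsmul] at hinv
  have h : f (0, x) = f (0, a • a • x) := Prod.ext (by simp only [hfst]) hinv
  exact hx (congrArg Prod.snd (f.injective h)).symm

end FibredAffine

/-- Multiplication by the class of `X` on `𝔽₂[X] ⧸ (X⁴ + X³ + X² + X + 1)`. -/
def cyclotomicFiveAut :
    (ZMod 2 × ZMod 2 × ZMod 2 × ZMod 2) ≃ₗ[ZMod 2] (ZMod 2 × ZMod 2 × ZMod 2 × ZMod 2) where
  toFun v := (v.2.2.2, v.1 + v.2.2.2, v.2.1 + v.2.2.2, v.2.2.1 + v.2.2.2)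
  invFun v := (v.2.1 - v.1, v.2.2.1 - v.1, v.2.2.2 - v.1, v.1)
  map_add' := by decide
  map_smul' := by decide
  left_inv := by intro v; simp
  right_inv := by intro v; simp

theorem cyclotomicFiveAut_pow : cyclotomicFiveAut ^ 5 = 1 := by
  ext v : 1
  revert v
  decide

theorem statement_6 :
    ¬ IsCIGroupTernary (Multiplicative (ZMod 5 × (ZMod 2 × ZMod 2 × ZMod 2 × ZMod 2))) := by
  exact not_isCIGroupTernary (by decide) (by decide) cyclotomicFiveAut_pow
    (x := (1, 0, 0, 0)) (by decide)
end

section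
/- Let p ≥ 2 be an integer dividing n, and let P₁ and P₂ be partitions of a set Ω of size n in which every part has size exactly p. Then there exists an even permutation φ of Ω such that φ maps P₁ to P₂, i.e., {φ(B) : B ∈ P₁} = P₂. -/
/-- A partition into parts of size `p` identifies the set with `P × Fin p`, the first coordinate
recording the part containing a point. -/
theorem exists_equiv_prod_fin_of_uniform_partition {Ω : Type*} [DecidableEq Ω]
    {p : ℕ} {P : Finset (Finset Ω)} (hpart : ∀ x : Ω, ∃! B, B ∈ P ∧ x ∈ B)
    (hsize : ∀ B ∈ P, B.card = p) :
    ∃ e : Ω ≃ P × Fin p, ∀ x (B : P), x ∈ B.1 ↔ (e x).1 = B := by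
  choose b hb huniq using hpart
  let f : Ω → P := fun x => ⟨b x, (hb x).1⟩
  have hf : ∀ x (B : P), x ∈ B.1 ↔ f x = B := by
    intro x B
    constructor
    · intro hx
      exact Subtype.ext (huniq x B.1 ⟨B.2, hx⟩).symm
    · rintro rfl
      exact (hb x).2
  have hfib : ∀ B : P, Nonempty ({x // f x = B} ≃ Fin p) := fun B =>
    ⟨(Equiv.subtypeEquivRight fun x => (hf x B).symm).trans
      (B.1.equivFinOfCardEq (hsize B.1 B.2))⟩
  let g := fun B => (hfib B).some
  refine ⟨(Equiv.sigmaFiberEquiv f).symm.trans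
    ((Equiv.sigmaCongrRight g).trans (Equiv.sigmaEquivProd P (Fin p))), fun x B => ?_⟩
  exact hf x B

theorem exists_perm_image_eq_of_uniform_partitions {Ω : Type*} [Fintype Ω] [DecidableEq Ω]
    {p : ℕ} (hp : 0 < p) {P₁ P₂ : Finset (Finset Ω)}
    (hpart₁ : ∀ x : Ω, ∃! B, B ∈ P₁ ∧ x ∈ B)
    (hpart₂ : ∀ x : Ω, ∃! B, B ∈ P₂ ∧ x ∈ B)
    (hsize₁ : ∀ B ∈ P₁, B.card = p) (hsize₂ : ∀ B ∈ P₂, B.card = p) :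
    ∃ φ : Equiv.Perm Ω, P₁.image (fun B => B.image φ) = P₂ := by
  obtain ⟨e₁, he₁⟩ := exists_equiv_prod_fin_of_uniform_partition hpart₁ hsize₁
  obtain ⟨e₂, he₂⟩ := exists_equiv_prod_fin_of_uniform_partition hpart₂ hsize₂
  have hcard : Fintype.card P₁ = Fintype.card P₂ := by
    have h := Fintype.card_congr (e₁.symm.trans e₂)
    simp only [Fintype.card_prod, Fintype.card_fin] at h
    exact Nat.eq_of_mul_eq_mul_right hp h
  let f : P₁ ≃ P₂ := Fintype.equivOfCardEq hcard
  let φ : Equiv.Perm Ω := e₁.trans ((f.prodCongr (Equiv.refl (Fin p))).trans e₂.symm)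
  have hφ : ∀ B : P₁, B.1.image φ = (f B).1 := by
    intro B
    ext y
    obtain ⟨x, rfl⟩ := φ.surjective y
    rw [φ.injective.mem_finset_image, he₁, he₂]
    simp [φ]
  refine ⟨φ, ?_⟩
  ext C
  rw [Finset.mem_image]
  constructor
  · rintro ⟨B, hB, rfl⟩
    rw [hφ ⟨B, hB⟩]
    exact (f ⟨B, hB⟩).2
  · intro hC
    refine ⟨(f.symm ⟨C, hC⟩).1, (f.symm ⟨C, hC⟩).2, ?_⟩
    rw [hφ, f.apply_symm_apply]

theorem Finset.image_swap_eq_self {Ω : Type*} [DecidableEq Ω] {a b : Ω} {B : Finset Ω}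
    (h : a ∈ B ↔ b ∈ B) : B.image (Equiv.swap a b) = B := by
  ext y
  obtain ⟨x, rfl⟩ := (Equiv.swap a b).surjective y
  rw [(Equiv.swap a b).injective.mem_finset_image, Equiv.swap_apply_def]
  split_ifs <;> simp_all

theorem statement_7 {Ω : Type*} [Fintype Ω] [DecidableEq Ω] (n p : ℕ)
    (hn : Fintype.card Ω = n) (hp : 2 ≤ p) (hdvd : p ∣ n)
    (P₁ P₂ : Finset (Finset Ω))
    (hpart₁ : ∀ x : Ω, ∃! B, B ∈ P₁ ∧ x ∈ B)
    (hpart₂ : ∀ x : Ω, ∃! B, B ∈ P₂ ∧ x ∈ B)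
    (hsize₁ : ∀ B ∈ P₁, B.card = p) (hsize₂ : ∀ B ∈ P₂, B.card = p) :
    ∃ φ : Equiv.Perm Ω, Equiv.Perm.sign φ = 1 ∧
      P₁.image (fun B => B.image φ) = P₂ := by
  obtain ⟨φ, hφ⟩ := exists_perm_image_eq_of_uniform_partitions (by omega) hpart₁ hpart₂
    hsize₁ hsize₂
  rcases Int.units_eq_one_or (Equiv.Perm.sign φ) with hs | hs
  · exact ⟨φ, hs, hφ⟩
  rcases isEmpty_or_nonempty Ω with hΩ | ⟨⟨x⟩⟩
  · exact ⟨φ, by rw [Subsingleton.elim φ 1, Equiv.Perm.sign_one], hφ⟩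
  obtain ⟨B, ⟨hB, -⟩, -⟩ := hpart₁ x
  obtain ⟨a, ha, b, hb, hab⟩ := Finset.one_lt_card.mp (show 1 < B.card by rw [hsize₁ B hB]; omega)
  refine ⟨φ * Equiv.swap a b, by simp [hs, Equiv.Perm.sign_swap hab], ?_⟩
  rw [← hφ]
  refine Finset.image_congr fun C hC => ?_
  have hmem : a ∈ C ↔ b ∈ C :=
    ⟨fun h => (hpart₁ a).unique ⟨hB, ha⟩ ⟨hC, h⟩ ▸ hb,
      fun h => (hpart₁ b).unique ⟨hB, hb⟩ ⟨hC, h⟩ ▸ ha⟩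
  simp only [Equiv.Perm.coe_mul]
  rw [← Finset.image_image, Finset.image_swap_eq_self hmem]
end

section
/- Let p be a prime, let H = ℤ_2³ × ℤ_p, let G = H_L ≤ Sym(H) be its left regular representation, and let δ be a permutation of H. Suppose the group K = ⟨G, δ⁻¹Gδ⟩ admits a complete block system 𝒞 consisting of p blocks of size 8 such that for each block C ∈ 𝒞 the permutation group induced on C by the setwise stabilizer Stab_K(C) contains the alternating group Alt(C). Then there exists γ ∈ K such that ⟨G, γ⁻¹δ⁻¹Gδγ⟩ admits a complete block system consisting of 4p blocks of size 2. -/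
/-- The conjugate subgroup `φ⁻¹ K φ`. -/
def conjBy {Ω : Type*} (φ : Equiv.Perm Ω) (K : Subgroup (Equiv.Perm Ω)) :
    Subgroup (Equiv.Perm Ω) :=
  K.map (MulAut.conj φ⁻¹).toMonoidHom

/-- `𝒞` is a complete block system for the permutation group `K`:
a `K`-invariant partition of the permuted set. -/
def IsCompleteBlockSystem {Ω : Type*} [DecidableEq Ω]
    (K : Subgroup (Equiv.Perm Ω)) (𝒞 : Finset (Finset Ω)) : Prop :=
  (∀ x : Ω, ∃! B, B ∈ 𝒞 ∧ x ∈ B) ∧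
  ∀ B ∈ 𝒞, ∀ g ∈ K, B.image (g : Ω → Ω) ∈ 𝒞

/-- The group `ℤ_2³ × ℤ_p`. -/
abbrev Hgrp (p : ℕ) := Multiplicative ((ZMod 2 × ZMod 2 × ZMod 2) × ZMod p)

open Equiv Equiv.Perm in
theorem alternatingGroup_le_of_conj_mem {α : Type*} [Fintype α] [DecidableEq α]
    (hα : 5 ≤ Nat.card α) (Q : Subgroup (Equiv.Perm α)) (hQ : Q ≠ ⊥)
    (hconj : ∀ τ ∈ alternatingGroup α, ∀ q ∈ Q, τ * q * τ⁻¹ ∈ Q) :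
    alternatingGroup α ≤ Q := by
  have hnormal : (Q.subgroupOf (alternatingGroup α)).Normal :=
    ⟨fun n hn g ↦ by
      rw [Subgroup.mem_subgroupOf] at hn ⊢
      exact hconj g g.2 n hn⟩
  rcases alternatingGroup.normal_subgroup_eq_bot_or_eq_top hα
    (N := Q.subgroupOf (alternatingGroup α)) with h | h
  · exfalso
    rw [Subgroup.subgroupOf_eq_bot, Subgroup.disjoint_def] at h
    apply hQ
    rw [Subgroup.eq_bot_iff_forall]
    intro q hq
    have hcomm : ∀ τ ∈ alternatingGroup α, τ * q = q * τ := by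
      intro τ hτ
      have h1 : τ * q * τ⁻¹ * q⁻¹ = 1 := by
        refine h (Q.mul_mem (hconj τ hτ q hq) (Q.inv_mem hq)) ?_
        rw [mem_alternatingGroup]
        simp only [Perm.sign_mul, sign_inv]
        rw [mul_right_comm, mul_assoc _ _ (sign q)]
        simp [mul_comm (sign τ)]
      rwa [mul_inv_eq_one, mul_inv_eq_iff_eq_mul] at h1
    by_contra hq1
    obtain ⟨x, hx⟩ : ∃ x, q x ≠ x := by
      by_contra! hall
      exact hq1 (Equiv.ext hall)
    have hcard : 2 < (({x, q x} : Finset α)ᶜ).card := by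
      rw [Finset.card_compl, Finset.card_pair (Ne.symm hx), ← Nat.card_eq_fintype_card]
      omega
    obtain ⟨a, b, -, ha, hb, -, hab, -, -⟩ := Finset.two_lt_card_iff.mp hcard
    simp only [Finset.mem_compl, Finset.mem_insert, Finset.mem_singleton, not_or] at ha hb
    have hτ : swap (q x) a * swap (q x) b ∈ alternatingGroup α := by
      rw [mem_alternatingGroup, Perm.sign_mul, sign_swap (Ne.symm ha.2), sign_swap (Ne.symm hb.2)]
      simp
    have h2 := DFunLike.congr_fun (hcomm _ hτ) x
    simp only [Perm.mul_apply, swap_apply_left] at h2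
    rw [swap_apply_of_ne_of_ne hb.2 (Ne.symm hab),
      swap_apply_of_ne_of_ne (Ne.symm hx) (Ne.symm hb.1),
      swap_apply_of_ne_of_ne (Ne.symm hx) (Ne.symm ha.1)] at h2
    exact hb.2 h2
  · rwa [Subgroup.subgroupOf_eq_top] at h

open Equiv Equiv.Perm in
theorem exists_alternating_mul_eq_mul {α : Type*} [Fintype α] [DecidableEq α]
    [Nonempty α] (z w : Equiv.Perm α) (hz : ∀ x, z x ≠ x) (hz2 : z * z = 1)
    (hw : ∀ x, w x ≠ x) (hw2 : w * w = 1) :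
    ∃ τ ∈ alternatingGroup α, w * τ = τ * z := by
  have hsupp : ∀ u : Equiv.Perm α, (∀ x, u x ≠ x) → u.support = Finset.univ := fun u hu ↦ by
    ext x
    simp [hu x]
  have htype : ∀ u : Equiv.Perm α, (∀ x, u x ≠ x) → u * u = 1 →
      u.cycleType = Multiset.replicate (Fintype.card α / 2) 2 := fun u hu hu2 ↦ by
    have : Fact (Nat.Prime 2) := ⟨Nat.prime_two⟩
    have h := cycleType_of_pow_prime_eq_one (p := 2) (σ := u) (by rw [pow_two, hu2])
    have hsum := sum_cycleType u
    rw [hsupp u hu, h, Finset.card_univ] at hsum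
    rw [h, ← hsum]
    simp
  obtain ⟨σ, hσ⟩ := isConj_iff.mp
    (isConj_of_cycleType_eq ((htype z hz hz2).trans (htype w hw hw2).symm))
  rw [mul_inv_eq_iff_eq_mul] at hσ
  rcases Int.units_eq_one_or (sign σ) with hs | hs
  · exact ⟨σ, mem_alternatingGroup.mpr hs, hσ.symm⟩
  · obtain ⟨x⟩ := ‹Nonempty α›
    refine ⟨σ * swap x (z x), ?_, ?_⟩
    · rw [mem_alternatingGroup, Perm.sign_mul, hs, sign_swap (Ne.symm (hz x))]
      simp
    · have hzz : z (z x) = x := DFunLike.congr_fun hz2 x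
      have : z * swap x (z x) = swap x (z x) * z := by
        rw [mul_swap_eq_swap_mul, hzz, swap_comm]
      rw [← mul_assoc, ← hσ, mul_assoc, this, mul_assoc]

/-- The permutations of `C` induced by the elements of `L` stabilizing `C`. -/
def inducedOn {Ω : Type*} (L : Subgroup (Equiv.Perm Ω)) (C : Finset Ω) :
    Subgroup (Equiv.Perm C) where
  carrier := {τ | ∃ g ∈ L, ∀ y : C, g y = τ y}
  mul_mem' := by
    rintro a b ⟨g, hg, hga⟩ ⟨h, hh, hhb⟩
    exact ⟨g * h, L.mul_mem hg hh, fun y ↦ by simp [hga, hhb]⟩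
  one_mem' := ⟨1, L.one_mem, fun y ↦ rfl⟩
  inv_mem' := by
    rintro a ⟨g, hg, hga⟩
    refine ⟨g⁻¹, L.inv_mem hg, fun y ↦ ?_⟩
    rw [Equiv.Perm.inv_eq_iff_eq, hga]
    simp

theorem alternatingGroup_le_inducedOn {Ω : Type*} [DecidableEq Ω]
    (A L : Subgroup (Equiv.Perm Ω)) (C : Finset Ω) (hC : 5 ≤ C.card)
    (hnorm : ∀ a ∈ A, ∀ l ∈ L, a * l * a⁻¹ ∈ L)
    (hA : alternatingGroup C ≤ inducedOn A C)
    (l : Equiv.Perm Ω) (hlL : l ∈ L) (hlC : ∀ x, l x ∈ C ↔ x ∈ C)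
    (hl : ∃ x ∈ C, l x ≠ x) :
    alternatingGroup C ≤ inducedOn L C := by
  apply alternatingGroup_le_of_conj_mem (by simpa using hC)
  · intro hbot
    obtain ⟨x, hx, hlx⟩ := hl
    have hmem : l.subtypePerm hlC ∈ inducedOn L C := ⟨l, hlL, fun y ↦ rfl⟩
    rw [hbot, Subgroup.mem_bot] at hmem
    have := DFunLike.congr_fun hmem ⟨x, hx⟩
    exact hlx (congrArg Subtype.val this)
  · intro τ hτ q hq
    obtain ⟨a, ha, haτ⟩ := hA hτ
    obtain ⟨m, hm, hmq⟩ := hq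
    refine ⟨a * m * a⁻¹, hnorm a ha m hm, fun y ↦ ?_⟩
    have hinv : a⁻¹ (y : Ω) = (τ⁻¹ y : C) := by
      rw [Equiv.Perm.inv_eq_iff_eq, haτ]
      simp
    simp only [Equiv.Perm.mul_apply, hinv, hmq, haτ]

/-- The elements of `K` stabilizing every member of `𝒞`. -/
def blockKernel {Ω : Type*} (K : Subgroup (Equiv.Perm Ω)) (𝒞 : Finset (Finset Ω)) :
    Subgroup (Equiv.Perm Ω) where
  carrier := {g | g ∈ K ∧ ∀ C ∈ 𝒞, ∀ x, g x ∈ C ↔ x ∈ C}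
  mul_mem' := by
    rintro a b ⟨ha, ha'⟩ ⟨hb, hb'⟩
    exact ⟨K.mul_mem ha hb, fun C hC x ↦ by
      rw [Equiv.Perm.mul_apply, ha' C hC, hb' C hC]⟩
  one_mem' := ⟨K.one_mem, fun C _ x ↦ Iff.rfl⟩
  inv_mem' := by
    rintro a ⟨ha, ha'⟩
    refine ⟨K.inv_mem ha, fun C hC x ↦ ?_⟩
    rw [← ha' C hC, Equiv.Perm.inv_def, Equiv.apply_symm_apply]

/-- The elements of `N` that fix every point of every member of `𝒥`. -/
def blockFixing {Ω : Type*} (N : Subgroup (Equiv.Perm Ω)) (𝒥 : Finset (Finset Ω)) :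
    Subgroup (Equiv.Perm Ω) where
  carrier := {g | g ∈ N ∧ ∀ C ∈ 𝒥, ∀ x ∈ C, g x = x}
  mul_mem' := by
    rintro a b ⟨ha, ha'⟩ ⟨hb, hb'⟩
    exact ⟨N.mul_mem ha hb, fun C hC x hx ↦ by
      rw [Equiv.Perm.mul_apply, hb' C hC x hx, ha' C hC x hx]⟩
  one_mem' := ⟨N.one_mem, fun C _ x _ ↦ rfl⟩
  inv_mem' := by
    rintro a ⟨ha, ha'⟩
    refine ⟨N.inv_mem ha, fun C hC x hx ↦ ?_⟩
    rw [Equiv.Perm.inv_eq_iff_eq, ha' C hC x hx]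

theorem IsCompleteBlockSystem.mono {Ω : Type*} [DecidableEq Ω]
    {K L : Subgroup (Equiv.Perm Ω)} {𝒞 : Finset (Finset Ω)}
    (h : IsCompleteBlockSystem K 𝒞) (hL : L ≤ K) : IsCompleteBlockSystem L 𝒞 :=
  ⟨h.1, fun B hB g hg ↦ h.2 B hB g (hL hg)⟩

theorem IsCompleteBlockSystem.eq_of_mem {Ω : Type*} [DecidableEq Ω]
    {K : Subgroup (Equiv.Perm Ω)} {𝒞 : Finset (Finset Ω)}
    (h : IsCompleteBlockSystem K 𝒞) {B C : Finset Ω} (hB : B ∈ 𝒞) (hC : C ∈ 𝒞) {x : Ω}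
    (hxB : x ∈ B) (hxC : x ∈ C) : B = C :=
  (h.1 x).unique ⟨hB, hxB⟩ ⟨hC, hxC⟩

theorem IsCompleteBlockSystem.exists_preimage {Ω : Type*} [DecidableEq Ω]
    {K : Subgroup (Equiv.Perm Ω)} {𝒞 : Finset (Finset Ω)}
    (h : IsCompleteBlockSystem K 𝒞) {C : Finset Ω} (hC : C ∈ 𝒞) {g : Equiv.Perm Ω}
    (hg : g ∈ K) : ∃ D ∈ 𝒞, ∀ y, g y ∈ C ↔ y ∈ D := by
  refine ⟨_, h.2 C hC g⁻¹ (K.inv_mem hg), fun y ↦ ?_⟩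
  rw [Finset.mem_image]
  constructor
  · intro hy
    exact ⟨g y, hy, by simp⟩
  · rintro ⟨a, ha, rfl⟩
    simpa using ha

theorem IsCompleteBlockSystem.conj_mem_blockKernel {Ω : Type*} [DecidableEq Ω]
    {K : Subgroup (Equiv.Perm Ω)} {𝒞 : Finset (Finset Ω)}
    (h : IsCompleteBlockSystem K 𝒞) {a l : Equiv.Perm Ω} (ha : a ∈ K)
    (hl : l ∈ blockKernel K 𝒞) : a * l * a⁻¹ ∈ blockKernel K 𝒞 := by
  refine ⟨K.mul_mem (K.mul_mem ha hl.1) (K.inv_mem ha), fun C hC x ↦ ?_⟩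
  obtain ⟨D, hD, hDC⟩ := h.exists_preimage hC ha
  rw [Equiv.Perm.mul_apply, Equiv.Perm.mul_apply, hDC, hl.2 D hD, ← hDC,
    Equiv.Perm.inv_def, Equiv.apply_symm_apply]

theorem conj_mem_blockFixing {Ω : Type*} {K : Subgroup (Equiv.Perm Ω)}
    {𝒞 𝒥 : Finset (Finset Ω)} (h𝒥 : 𝒥 ⊆ 𝒞) {a l : Equiv.Perm Ω} (ha : a ∈ blockKernel K 𝒞)
    (hl : l ∈ blockFixing (blockKernel K 𝒞) 𝒥) :
    a * l * a⁻¹ ∈ blockFixing (blockKernel K 𝒞) 𝒥 := by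
  refine ⟨mul_mem (mul_mem ha hl.1) (inv_mem ha), fun C hC x hx ↦ ?_⟩
  have hx' : a⁻¹ x ∈ C := by
    rwa [← ha.2 C (h𝒥 hC), Equiv.Perm.inv_def, Equiv.apply_symm_apply]
  rw [Equiv.Perm.mul_apply, Equiv.Perm.mul_apply, hl.2 C hC _ hx', Equiv.Perm.inv_def,
    Equiv.apply_symm_apply]

/-- There is a set `𝒥` of blocks on which the block kernel acts faithfully, while it induces at
least the alternating group on each member of `𝒥` independently of the others. -/
theorem exists_independent_blocks {Ω : Type*} [DecidableEq Ω]
    (K : Subgroup (Equiv.Perm Ω)) (𝒞 : Finset (Finset Ω)) (h : IsCompleteBlockSystem K 𝒞)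
    (hsize : ∀ C ∈ 𝒞, 5 ≤ C.card) (halt : ∀ C ∈ 𝒞, alternatingGroup C ≤ inducedOn K C)
    (z : Equiv.Perm Ω) (hz : z ∈ blockKernel K 𝒞) (hzf : ∀ x, z x ≠ x) :
    ∃ 𝒥 ⊆ 𝒞, blockFixing (blockKernel K 𝒞) 𝒥 = ⊥ ∧
      ∀ C ∈ 𝒥, alternatingGroup C ≤
        inducedOn (blockFixing (blockKernel K 𝒞) (𝒥.erase C)) C := by
  have hfaithful : blockFixing (blockKernel K 𝒞) 𝒞 = ⊥ := by
    rw [Subgroup.eq_bot_iff_forall]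
    intro g hg
    ext x
    obtain ⟨B, ⟨hB, hxB⟩, -⟩ := h.1 x
    exact hg.2 B hB x hxB
  obtain ⟨𝒥, h𝒥𝒞, hmin⟩ := exists_minimal_le_of_wellFoundedLT
    (fun 𝒥 ↦ blockFixing (blockKernel K 𝒞) 𝒥 = ⊥) 𝒞 hfaithful
  refine ⟨𝒥, h𝒥𝒞, hmin.prop, fun C hC ↦ ?_⟩
  have hC𝒞 := h𝒥𝒞 hC
  have hkernel : alternatingGroup C ≤ inducedOn (blockKernel K 𝒞) C := by
    obtain ⟨x, hx⟩ : C.Nonempty := Finset.card_pos.mp (by have := hsize C hC𝒞; omega)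
    exact alternatingGroup_le_inducedOn K _ C (hsize C hC𝒞)
      (fun a ha l hl ↦ h.conj_mem_blockKernel ha hl) (halt C hC𝒞) z hz (hz.2 C hC𝒞)
      ⟨x, hx, hzf x⟩
  have hne : blockFixing (blockKernel K 𝒞) (𝒥.erase C) ≠ ⊥ := fun hbot ↦
    hmin.not_prop_of_lt (Finset.erase_ssubset hC) hbot
  obtain ⟨g, hg, hg1⟩ := Subgroup.bot_or_exists_ne_one _ |>.resolve_left hne
  refine alternatingGroup_le_inducedOn (blockKernel K 𝒞) _ C (hsize C hC𝒞)
    (fun a ha l hl ↦ conj_mem_blockFixing ((Finset.erase_subset _ _).trans h𝒥𝒞) ha hl)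
    hkernel g hg (hg.1.2 C hC𝒞) ?_
  by_contra! hfix
  refine hg1 ((Subgroup.eq_bot_iff_forall _).mp hmin.prop g ⟨hg.1, fun D hD x hx ↦ ?_⟩)
  by_cases hDC : D = C
  · exact hfix x (hDC ▸ hx)
  · exact hg.2 D (Finset.mem_erase.mpr ⟨hDC, hD⟩) x hx

/-- Fixed-point-free involutions of the block kernel are conjugate in it. -/
theorem exists_mul_eq_mul_of_involutions {Ω : Type*} [DecidableEq Ω]
    (K : Subgroup (Equiv.Perm Ω)) (𝒞 : Finset (Finset Ω)) (h : IsCompleteBlockSystem K 𝒞)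
    (hsize : ∀ C ∈ 𝒞, 5 ≤ C.card) (halt : ∀ C ∈ 𝒞, alternatingGroup C ≤ inducedOn K C)
    (z w : Equiv.Perm Ω) (hz : z ∈ blockKernel K 𝒞) (hzf : ∀ x, z x ≠ x) (hz2 : z * z = 1)
    (hw : w ∈ blockKernel K 𝒞) (hwf : ∀ x, w x ≠ x) (hw2 : w * w = 1) :
    ∃ m ∈ blockKernel K 𝒞, w * m = m * z := by
  obtain ⟨𝒥, h𝒥𝒞, hbot, hind⟩ := exists_independent_blocks K 𝒞 h hsize halt z hz hzf
  have key : ∀ S ⊆ 𝒥, ∃ m ∈ blockKernel K 𝒞, ∀ C ∈ S, ∀ x ∈ C, w (m x) = m (z x) := by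
    intro S
    induction S using Finset.induction_on with
    | empty => exact fun _ ↦ ⟨1, one_mem _, by simp⟩
    | insert C S hCS ih =>
      intro hS
      obtain ⟨hC, hS𝒥⟩ := Finset.insert_subset_iff.mp hS
      obtain ⟨m, hm, hmS⟩ := ih hS𝒥
      have hC𝒞 := h𝒥𝒞 hC
      have hconj : m⁻¹ * w * m ∈ blockKernel K 𝒞 := mul_mem (mul_mem (inv_mem hm) hw) hm
      have : Nonempty C := (Finset.card_pos.mp (by have := hsize C hC𝒞; omega)).to_subtype
      obtain ⟨τ, hτ, hτz⟩ := exists_alternating_mul_eq_mul (α := C)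
        (z.subtypePerm (hz.2 C hC𝒞)) ((m⁻¹ * w * m).subtypePerm (hconj.2 C hC𝒞))
        (fun x hx ↦ hzf x (congrArg Subtype.val hx))
        (by ext x; exact DFunLike.congr_fun hz2 (x : Ω))
        (fun x hx ↦ hwf (m x) (Equiv.Perm.inv_eq_iff_eq.mp (congrArg Subtype.val hx)))
        (by
          ext x
          change (m⁻¹ * w * m * (m⁻¹ * w * m)) x = x
          have : m⁻¹ * w * m * (m⁻¹ * w * m) = m⁻¹ * (w * w) * m := by group
          rw [this, hw2]
          simp)
      obtain ⟨k, hk, hkτ⟩ := hind C hC hτ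
      refine ⟨m * k, mul_mem hm hk.1, fun D hD x hx ↦ ?_⟩
      rcases Finset.mem_insert.mp hD with rfl | hD
      · have h1 := congrArg Subtype.val (DFunLike.congr_fun hτz ⟨x, hx⟩)
        have h2 := hkτ ⟨x, hx⟩
        have h3 := hkτ ⟨z x, (hz.2 D hC𝒞 x).mpr hx⟩
        simp only [Equiv.Perm.mul_apply, Equiv.Perm.subtypePerm_apply,
          Equiv.Perm.inv_eq_iff_eq] at h1 h2 h3 ⊢
        rw [h2, h3, h1]
      · have hD' : D ∈ 𝒥.erase C :=
          Finset.mem_erase.mpr ⟨fun hDC ↦ hCS (hDC ▸ hD), hS𝒥 hD⟩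
        rw [Equiv.Perm.mul_apply, Equiv.Perm.mul_apply, hk.2 D hD' x hx,
          hk.2 D hD' (z x) ((hz.2 D (h𝒥𝒞 (hS𝒥 hD)) x).mpr hx), hmS D hD x hx]
  obtain ⟨m, hm, hm𝒥⟩ := key 𝒥 subset_rfl
  refine ⟨m, hm, ?_⟩
  have := (Subgroup.eq_bot_iff_forall _).mp hbot ((m * z)⁻¹ * (w * m))
    ⟨mul_mem (inv_mem (mul_mem hm hz)) (mul_mem hw hm), fun C hC x hx ↦ by
      rw [Equiv.Perm.mul_apply, Equiv.Perm.inv_eq_iff_eq]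
      exact hm𝒥 C hC x hx⟩
  exact (inv_mul_eq_one.mp this).symm

/-- A regular abelian group preserving a block system with a block of even size contains an
involution stabilizing every block. -/
theorem exists_involution_mem_blockKernel {Ω : Type*} [Finite Ω] [DecidableEq Ω]
    (R : Subgroup (Equiv.Perm Ω)) (hcomm : ∀ a ∈ R, ∀ b ∈ R, a * b = b * a)
    (hreg : ∀ x y, ∃! r, r ∈ R ∧ r x = y)
    (𝒞 : Finset (Finset Ω)) (h : IsCompleteBlockSystem R 𝒞) (hne : ∀ B ∈ 𝒞, B.Nonempty)
    (C : Finset Ω) (hC : C ∈ 𝒞) (heven : 2 ∣ C.card) :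
    ∃ z ∈ blockKernel R 𝒞, (∀ x, z x ≠ x) ∧ z * z = 1 := by
  obtain ⟨c, hc⟩ := hne C hC
  have hmem : ∀ r ∈ R, ∀ B ∈ 𝒞, ∀ b ∈ B, r b ∈ B → ∀ x, r x ∈ B ↔ x ∈ B := by
    intro r hr B hB b hb hrb x
    obtain ⟨D, hD, hDB⟩ := h.exists_preimage hB hr
    rw [hDB, h.eq_of_mem hD hB ((hDB b).mp hrb) hb]
  have hcard : Nat.card (blockKernel R {C}) = C.card := by
    have hbij : Function.Bijective fun r : blockKernel R {C} ↦
        (⟨r.1 c, (r.2.2 C (Finset.mem_singleton_self C) c).mpr hc⟩ : C) := by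
      constructor
      · rintro ⟨r, hr⟩ ⟨s, hs⟩ hrs
        exact Subtype.ext
          ((hreg c (s c)).unique ⟨hr.1, congrArg Subtype.val hrs⟩ ⟨hs.1, rfl⟩)
      · rintro ⟨b, hb⟩
        obtain ⟨r, ⟨hr, rfl⟩, -⟩ := hreg c b
        exact ⟨⟨r, hr, by simpa using hmem r hr C hC c hc hb⟩, rfl⟩
    rw [Nat.card_eq_of_bijective _ hbij, Nat.card_eq_fintype_card, Fintype.card_coe]
  have : Fact (Nat.Prime 2) := ⟨Nat.prime_two⟩
  obtain ⟨⟨z, hz⟩, hz2⟩ := exists_prime_orderOf_dvd_card' (G := blockKernel R {C}) 2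
    (hcard ▸ heven)
  have hzC := hz.2 C (Finset.mem_singleton_self C)
  rw [Subgroup.orderOf_mk] at hz2
  refine ⟨z, ⟨hz.1, fun B hB ↦ ?_⟩, fun x hx ↦ ?_, ?_⟩
  · obtain ⟨b, hb⟩ := hne B hB
    obtain ⟨r, ⟨hr, hrb⟩, -⟩ := hreg c b
    refine hmem z hz.1 B hB b hb ?_
    obtain ⟨D, hD, hDB⟩ := h.exists_preimage hB hr
    have hDC : D = C := h.eq_of_mem hD hC ((hDB c).mp (hrb ▸ hb)) hc
    rw [← hrb, ← Equiv.Perm.mul_apply, hcomm z hz.1 r hr, Equiv.Perm.mul_apply, hDB, hDC, hzC]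
    exact hc
  · have : z = 1 := (hreg x x).unique ⟨hz.1, hx⟩ ⟨R.one_mem, rfl⟩
    rw [this, orderOf_one] at hz2
    omega
  · rw [← pow_two, ← hz2, pow_orderOf_eq_one]

/-- The orbits of a fixed-point-free involution centralized by `L` form a block system. -/
theorem exists_blockSystem_of_involution {Ω : Type*} [Fintype Ω] [DecidableEq Ω]
    (L : Subgroup (Equiv.Perm Ω)) (z : Equiv.Perm Ω) (hzf : ∀ x, z x ≠ x) (hz2 : z * z = 1)
    (hL : ∀ g ∈ L, g * z = z * g) :
    ∃ ℬ : Finset (Finset Ω), IsCompleteBlockSystem L ℬ ∧ ℬ.card * 2 = Fintype.card Ω ∧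
      ∀ B ∈ ℬ, B.card = 2 := by
  have hzz : ∀ x, z (z x) = x := fun x ↦ DFunLike.congr_fun hz2 x
  let ℬ : Finset (Finset Ω) := Finset.univ.image fun x ↦ {x, z x}
  have hmem : ∀ B, B ∈ ℬ ↔ ∃ x, {x, z x} = B := fun B ↦ by simp [ℬ]
  have huniq : ∀ x : Ω, ∃! B, B ∈ ℬ ∧ x ∈ B := by
    intro x
    refine ⟨{x, z x}, ⟨(hmem _).mpr ⟨x, rfl⟩, by simp⟩, ?_⟩
    rintro B ⟨hB, hx⟩
    obtain ⟨y, rfl⟩ := (hmem _).mp hB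
    rcases Finset.mem_insert.mp hx with rfl | hx
    · rfl
    · rw [Finset.mem_singleton.mp hx, hzz, Finset.pair_comm]
  have hcard : ∀ B ∈ ℬ, B.card = 2 := by
    intro B hB
    obtain ⟨x, rfl⟩ := (hmem _).mp hB
    exact Finset.card_pair (Ne.symm (hzf x))
  refine ⟨ℬ, ⟨huniq, fun B hB g hg ↦ ?_⟩, ?_, hcard⟩
  · obtain ⟨x, rfl⟩ := (hmem _).mp hB
    refine (hmem _).mpr ⟨g x, ?_⟩
    have : g (z x) = z (g x) := DFunLike.congr_fun (hL g hg) x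
    rw [Finset.image_insert, Finset.image_singleton, this]
  · have hdisj : (ℬ : Set (Finset Ω)).PairwiseDisjoint id := fun A hA B hB hAB ↦
      Finset.disjoint_left.mpr fun x hxA hxB ↦
        hAB ((huniq x).unique ⟨hA, hxA⟩ ⟨hB, hxB⟩)
    have hunion : ℬ.biUnion id = Finset.univ := by
      ext x
      obtain ⟨B, hB, -⟩ := huniq x
      simpa using ⟨B, hB⟩
    rw [← Finset.card_univ, ← hunion, Finset.card_biUnion hdisj]
    exact (Finset.sum_const_nat hcard).symm

theorem leftRegular_comm {H : Type*} [CommGroup H] :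
    ∀ a ∈ leftRegular H, ∀ b ∈ leftRegular H, a * b = b * a := by
  rintro _ ⟨a, rfl⟩ _ ⟨b, rfl⟩
  rw [← map_mul, mul_comm, map_mul]

theorem leftRegular_regular {H : Type*} [Group H] (x y : H) :
    ∃! r, r ∈ leftRegular H ∧ r x = y := by
  refine ⟨MulAction.toPermHom H H (y * x⁻¹), ⟨⟨_, rfl⟩, by simp⟩, ?_⟩
  rintro _ ⟨⟨a, rfl⟩, rfl⟩
  simp

theorem mem_conjBy {Ω : Type*} {φ g : Equiv.Perm Ω} {K : Subgroup (Equiv.Perm Ω)} :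
    g ∈ conjBy φ K ↔ φ * g * φ⁻¹ ∈ K := by
  rw [conjBy, Subgroup.mem_map]
  constructor
  · rintro ⟨k, hk, rfl⟩
    simpa [mul_assoc] using hk
  · exact fun hg ↦ ⟨_, hg, by simp [mul_assoc]⟩

theorem conjBy_comm {Ω : Type*} (φ : Equiv.Perm Ω) {K : Subgroup (Equiv.Perm Ω)}
    (hK : ∀ a ∈ K, ∀ b ∈ K, a * b = b * a) :
    ∀ a ∈ conjBy φ K, ∀ b ∈ conjBy φ K, a * b = b * a := by
  rintro _ ⟨a, ha, rfl⟩ _ ⟨b, hb, rfl⟩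
  rw [← map_mul, hK a ha b hb, map_mul]

theorem conjBy_regular {Ω : Type*} (φ : Equiv.Perm Ω) {K : Subgroup (Equiv.Perm Ω)}
    (hK : ∀ x y, ∃! r, r ∈ K ∧ r x = y) (x y : Ω) :
    ∃! r, r ∈ conjBy φ K ∧ r x = y := by
  obtain ⟨r, ⟨hr, hrx⟩, huniq⟩ := hK (φ x) (φ y)
  refine ⟨φ⁻¹ * r * φ, ⟨mem_conjBy.mpr (by simpa [mul_assoc] using hr), by simp [hrx]⟩, ?_⟩
  rintro s ⟨hs, rfl⟩
  rw [← huniq (φ * s * φ⁻¹) ⟨mem_conjBy.mp hs, by simp⟩]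
  simp [mul_assoc]

theorem conjBy_mul {Ω : Type*} (φ ψ : Equiv.Perm Ω) (K : Subgroup (Equiv.Perm Ω)) :
    conjBy (φ * ψ) K = conjBy ψ (conjBy φ K) := by
  ext g
  simp [mem_conjBy, mul_assoc]

theorem blockKernel_mono {Ω : Type*} {K L : Subgroup (Equiv.Perm Ω)} (h : L ≤ K)
    (𝒞 : Finset (Finset Ω)) : blockKernel L 𝒞 ≤ blockKernel K 𝒞 :=
  fun _ hg ↦ ⟨h hg.1, hg.2⟩

theorem statement_8 (p : ℕ) (hp : p.Prime) (δ : Equiv.Perm (Hgrp p))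
    (𝒞 : Finset (Finset (Hgrp p)))
    (hbs : IsCompleteBlockSystem
      (leftRegular (Hgrp p) ⊔ conjBy δ (leftRegular (Hgrp p))) 𝒞)
    (hnum : 𝒞.card = p) (hsize : ∀ C ∈ 𝒞, C.card = 8)
    (halt : ∀ C ∈ 𝒞, ∀ τ ∈ alternatingGroup (↥C),
      ∃ g ∈ leftRegular (Hgrp p) ⊔ conjBy δ (leftRegular (Hgrp p)),
        C.image (g : Hgrp p → Hgrp p) = C ∧
        ∀ y : ↥C, g (y : Hgrp p) = ((τ y : ↥C) : Hgrp p)) :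
    ∃ γ ∈ leftRegular (Hgrp p) ⊔ conjBy δ (leftRegular (Hgrp p)),
      ∃ ℬ : Finset (Finset (Hgrp p)),
        IsCompleteBlockSystem
          (leftRegular (Hgrp p) ⊔ conjBy (δ * γ) (leftRegular (Hgrp p))) ℬ ∧
        ℬ.card = 4 * p ∧ ∀ B ∈ ℬ, B.card = 2 := by
  have : Fact p.Prime := ⟨hp⟩
  set G := leftRegular (Hgrp p)
  set K := G ⊔ conjBy δ G
  have halt' : ∀ C ∈ 𝒞, alternatingGroup C ≤ inducedOn K C := fun C hC τ hτ ↦ by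
    obtain ⟨g, hg, -, hgτ⟩ := halt C hC τ hτ
    exact ⟨g, hg, hgτ⟩
  obtain ⟨C, hC⟩ : 𝒞.Nonempty := Finset.card_pos.mp (hnum.symm ▸ hp.pos)
  have hne : ∀ B ∈ 𝒞, B.Nonempty := fun B hB ↦ Finset.card_pos.mp (by simp [hsize B hB])
  have heven : 2 ∣ C.card := by simp [hsize C hC]
  obtain ⟨z, hz, hzf, hz2⟩ := exists_involution_mem_blockKernel G leftRegular_comm
    leftRegular_regular 𝒞 (hbs.mono le_sup_left) hne C hC heven
  obtain ⟨w, hw, hwf, hw2⟩ := exists_involution_mem_blockKernel (conjBy δ G)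
    (conjBy_comm δ leftRegular_comm) (conjBy_regular δ leftRegular_regular) 𝒞
    (hbs.mono le_sup_right) hne C hC heven
  obtain ⟨m, hm, hwm⟩ := exists_mul_eq_mul_of_involutions K 𝒞 hbs
    (fun B hB ↦ by simp [hsize B hB]) halt' z w (blockKernel_mono le_sup_left 𝒞 hz) hzf hz2
    (blockKernel_mono le_sup_right 𝒞 hw) hwf hw2
  have hzm : z ∈ conjBy (δ * m) G := by
    rw [conjBy_mul, mem_conjBy, ← hwm]
    simpa using hw.1
  have hcentral : G ⊔ conjBy (δ * m) G ≤ Subgroup.centralizer {z} := by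
    refine sup_le (fun g hg ↦ ?_) (fun g hg ↦ ?_) <;> rw [Subgroup.mem_centralizer_singleton_iff]
    · exact leftRegular_comm g hg z hz.1
    · exact conjBy_comm _ leftRegular_comm g hg z hzm
  obtain ⟨ℬ, hℬ, hcard, hℬ2⟩ := exists_blockSystem_of_involution (G ⊔ conjBy (δ * m) G) z hzf hz2
    fun g hg ↦ Subgroup.mem_centralizer_singleton_iff.mp (hcentral hg)
  refine ⟨m, hm.1, ℬ, hℬ, ?_, hℬ2⟩
  have : Fintype.card (Hgrp p) = 8 * p := by
    simp [ZMod.card]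
  omega
end

section
/- Let p be a prime, ℓ < p a positive integer, and H a finite abelian group of order ℓp. Then for every permutation φ of H there exists δ ∈ ⟨H_L, φ⁻¹H_Lφ⟩ such that the group ⟨H_L, δ⁻¹φ⁻¹H_Lφδ⟩ admits a complete block system all of whose blocks have size p. -/
/-- The permutations that preserve an equivalence relation. -/
def setoidStabilizer {Ω : Type*} (r : Setoid Ω) : Subgroup (Equiv.Perm Ω) where
  carrier := {g | ∀ x y, r (g x) (g y) ↔ r x y}
  one_mem' := fun _ _ => Iff.rfl
  mul_mem' := fun {g h} hg hh x y => (hg (h x) (h y)).trans (hh x y)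
  inv_mem' := fun {g} hg x y => by
    simpa using (hg (g⁻¹ x) (g⁻¹ y)).symm

theorem centralizer_le_setoidStabilizer {Ω : Type*} (u : Equiv.Perm Ω) :
    Subgroup.centralizer {u} ≤ setoidStabilizer (Equiv.Perm.SameCycle.setoid u) := by
  intro g hg x y
  have hgu : u * g = g * u := Subgroup.mem_centralizer_iff.mp hg u rfl
  change u.SameCycle (g x) (g y) ↔ u.SameCycle x y
  have h := Equiv.Perm.sameCycle_conj (f := u) (g := g) (x := g x) (y := g y)
  rw [← hgu, mul_inv_cancel_right] at h
  simpa using h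

/-- The classes of an invariant equivalence relation form a complete block system. -/
theorem isCompleteBlockSystem_classes {Ω : Type*} [Fintype Ω] [DecidableEq Ω] (r : Setoid Ω)
    [DecidableRel r] {K : Subgroup (Equiv.Perm Ω)} (hK : K ≤ setoidStabilizer r) :
    IsCompleteBlockSystem K
      (Finset.univ.image fun x => Finset.univ.filter fun y => r x y) := by
  refine ⟨fun x => ⟨Finset.univ.filter fun y => r x y, ?_, ?_⟩, ?_⟩
  · simp
  · rintro B ⟨hB, hx⟩
    obtain ⟨z, -, rfl⟩ := Finset.mem_image.mp hB
    have hzx : r z x := by simpa using hx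
    ext y
    simp only [Finset.mem_filter, Finset.mem_univ, true_and]
    exact ⟨fun h => r.trans (r.symm hzx) h, fun h => r.trans hzx h⟩
  · intro B hB g hg
    obtain ⟨z, -, rfl⟩ := Finset.mem_image.mp hB
    refine Finset.mem_image.mpr ⟨g z, Finset.mem_univ _, ?_⟩
    ext y
    simp only [Finset.mem_filter, Finset.mem_univ, true_and, Finset.mem_image]
    constructor
    · intro h
      refine ⟨g⁻¹ y, ?_, by simp⟩
      rw [← hK hg]
      simpa using h
    · rintro ⟨w, hw, rfl⟩
      exact (hK hg z w).mpr hw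

/-- The cycles of a fixed-point-free permutation of prime order `p` have length `p`. -/
theorem ncard_sameCycle_eq {Ω : Type*} [Finite Ω] {p : ℕ} (hp : p.Prime) {u : Equiv.Perm Ω}
    (hu : u ^ p = 1) (hfix : ∀ x, u x ≠ x) (x : Ω) :
    {y | u.SameCycle x y}.ncard = p := by
  have hset : {y | u.SameCycle x y} = MulAction.orbit (Subgroup.zpowers u) x := by
    ext y
    simp [Equiv.Perm.SameCycle, MulAction.mem_orbit_iff, Subgroup.smul_def]
  have := Fact.mk hp
  have horder : orderOf u = p := orderOf_eq_prime hu fun h => hfix x (by simp [h])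
  have hdvd : (MulAction.orbit (Subgroup.zpowers u) x).ncard ∣ p := by
    rw [← horder, ← Nat.card_zpowers, ← MulAction.index_stabilizer]
    exact Subgroup.index_dvd_card _
  rw [hset]
  refine ((Nat.dvd_prime hp).mp hdvd).resolve_left fun h => ?_
  obtain ⟨z, hz⟩ := Set.ncard_eq_one.mp h
  have hx : x ∈ MulAction.orbit (Subgroup.zpowers u) x := MulAction.mem_orbit_self x
  have hux : u x ∈ MulAction.orbit (Subgroup.zpowers u) x :=
    ⟨⟨u, Subgroup.mem_zpowers u⟩, rfl⟩
  rw [hz, Set.mem_singleton_iff] at hx hux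
  exact hfix x (hux.trans hx.symm)

/-- On fewer than `p ^ 2` points, the orbits of a `p`-group are the cycles of any of its
fixed-point-free elements of order `p`. -/
theorem orbitRel_eq_sameCycle {Ω : Type*} [Finite Ω] {p : ℕ} (hp : p.Prime)
    (hcard : Nat.card Ω < p ^ 2) {Q : Subgroup (Equiv.Perm Ω)} (hQ : IsPGroup p Q)
    {u : Equiv.Perm Ω} (huQ : u ∈ Q) (hu : u ^ p = 1) (hfix : ∀ x, u x ≠ x) :
    MulAction.orbitRel Q Ω = Equiv.Perm.SameCycle.setoid u := by
  have := Fact.mk hp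
  ext x y
  have hsub : {z | u.SameCycle y z} ⊆ MulAction.orbit Q y := by
    rintro _ ⟨i, rfl⟩
    exact ⟨⟨u ^ i, Q.zpow_mem huQ i⟩, rfl⟩
  have hle : (MulAction.orbit Q y).ncard ≤ p := by
    obtain ⟨k, hk⟩ := hQ.card_orbit y
    rw [Nat.card_coe_set_eq] at hk
    have hlt : p ^ k < p ^ 2 :=
      hk ▸ (Set.ncard_le_card _).trans_lt hcard
    have hk1 : k < 2 := (Nat.pow_lt_pow_iff_right hp.one_lt).mp hlt
    calc _ = p ^ k := hk
      _ ≤ p ^ 1 := Nat.pow_le_pow_right hp.pos (by omega)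
      _ = p := pow_one p
  have heq := Set.eq_of_subset_of_ncard_le hsub
    (hle.trans_eq (ncard_sameCycle_eq hp hu hfix y).symm) (Set.toFinite _)
  rw [MulAction.orbitRel_apply, ← heq]
  exact Equiv.Perm.sameCycle_comm

/-- Up to conjugation by an element of `K`, two `p`-elements of `K` lie in a common
`p`-subgroup. -/
theorem exists_isPGroup_mem_conj_mem {G : Type*} [Group G] [Finite G] {p : ℕ} (hp : p.Prime)
    {K : Subgroup G} {u v : G} (huK : u ∈ K) (hvK : v ∈ K) (hu : u ^ p = 1) (hv : v ^ p = 1) :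
    ∃ δ ∈ K, ∃ Q : Subgroup G, IsPGroup p Q ∧ u ∈ Q ∧ δ⁻¹ * v * δ ∈ Q := by
  have := Fact.mk hp
  have key : ∀ w : K, w ^ p = 1 → ∃ S : Sylow p K, w ∈ S := by
    intro w hw
    have hpg : IsPGroup p (Subgroup.zpowers w) := by
      rintro ⟨_, i, rfl⟩
      refine ⟨1, Subtype.ext ?_⟩
      change (w ^ i) ^ p ^ 1 = 1
      rw [pow_one, ← zpow_natCast, ← zpow_mul, mul_comm, zpow_mul, zpow_natCast, hw, one_zpow]
    obtain ⟨S, hS⟩ := hpg.exists_le_sylow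
    exact ⟨S, hS (Subgroup.mem_zpowers w)⟩
  obtain ⟨S, hS⟩ := key ⟨u, huK⟩ (Subtype.ext hu)
  obtain ⟨T, hT⟩ := key ⟨v, hvK⟩ (Subtype.ext hv)
  obtain ⟨g, hg⟩ := MulAction.exists_smul_eq K S T
  refine ⟨g, g.2, (S : Subgroup K).map K.subtype, S.isPGroup'.map _, ⟨_, hS, rfl⟩, ?_⟩
  obtain ⟨s, hs, hsv⟩ : ⟨v, hvK⟩ ∈ g • S := hg ▸ hT
  refine ⟨g⁻¹ * ⟨v, hvK⟩ * g, ?_, rfl⟩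
  have hsv' : g * s * g⁻¹ = ⟨v, hvK⟩ := hsv
  rw [← hsv']
  simpa [mul_assoc] using hs

theorem statement_9 {H : Type*} [CommGroup H] [Fintype H] [DecidableEq H]
    (p ℓ : ℕ) (hp : p.Prime) (hℓ : 0 < ℓ) (hℓp : ℓ < p)
    (hcard : Fintype.card H = ℓ * p) (φ : Equiv.Perm H) :
    ∃ δ ∈ leftRegular H ⊔ conjBy φ (leftRegular H),
      ∃ ℬ : Finset (Finset H),
        IsCompleteBlockSystem (leftRegular H ⊔ conjBy (φ * δ) (leftRegular H)) ℬ ∧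
        ∀ B ∈ ℬ, B.card = p := by
  classical
  have := Fact.mk hp
  obtain ⟨a, ha⟩ := exists_prime_orderOf_dvd_card p (hcard ▸ Dvd.intro_left ℓ rfl)
  have hap : a ^ p = 1 := ha ▸ pow_orderOf_eq_one a
  have ha1 : a ≠ 1 := by
    rintro rfl
    exact hp.ne_one (ha.symm.trans orderOf_one)
  set u : Equiv.Perm H := MulAction.toPermHom H H a with hu_def
  have hu : u ^ p = 1 := by rw [hu_def, ← map_pow, hap, map_one]
  have hufix : ∀ x, u x ≠ x := fun x => by simpa [hu_def] using ha1
  have hL : leftRegular H ≤ Subgroup.centralizer {u} := by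
    rintro _ ⟨b, rfl⟩
    rw [Subgroup.mem_centralizer_iff]
    rintro _ rfl
    rw [hu_def, ← map_mul, ← map_mul, mul_comm]
  have hconj : ∀ ψ : Equiv.Perm H,
      conjBy ψ (leftRegular H) ≤ Subgroup.centralizer {ψ⁻¹ * u * ψ} := by
    rintro ψ _ ⟨g, hg, rfl⟩
    have hgu : u * g = g * u := Subgroup.mem_centralizer_iff.mp (hL hg) u rfl
    rw [Subgroup.mem_centralizer_iff]
    rintro _ rfl
    simpa [mul_assoc] using congrArg (· * ψ) hgu
  have huL : u ∈ leftRegular H := ⟨a, rfl⟩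
  have hpow : ∀ ψ : Equiv.Perm H, (ψ⁻¹ * u * ψ) ^ p = 1 := fun ψ => by
    simpa [hu] using conj_pow (i := p) (a := ψ⁻¹) (b := u)
  have hfix : ∀ (ψ : Equiv.Perm H) x, (ψ⁻¹ * u * ψ) x ≠ x := fun ψ x h =>
    hufix (ψ x) (by
      simpa using congrArg ψ h)
  have hvK : φ⁻¹ * u * φ ∈ conjBy φ (leftRegular H) := ⟨u, huL, by simp⟩
  obtain ⟨δ, hδ, Q, hQ, huQ, hvQ⟩ := exists_isPGroup_mem_conj_mem hp
    (K := leftRegular H ⊔ conjBy φ (leftRegular H))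
    (Subgroup.mem_sup_left huL) (Subgroup.mem_sup_right hvK) hu (hpow φ)
  have hw : δ⁻¹ * (φ⁻¹ * u * φ) * δ = (φ * δ)⁻¹ * u * (φ * δ) := by group
  rw [hw] at hvQ
  have hlt : Nat.card H < p ^ 2 := by
    rw [Nat.card_eq_fintype_card, hcard, sq]
    exact Nat.mul_lt_mul_of_pos_right hℓp hp.pos
  have h₁ := orbitRel_eq_sameCycle hp hlt hQ huQ hu hufix
  have h₂ := orbitRel_eq_sameCycle hp hlt hQ hvQ (hpow _) (hfix _)
  refine ⟨δ, hδ, _, isCompleteBlockSystem_classes (Equiv.Perm.SameCycle.setoid u) (sup_le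
    (hL.trans (centralizer_le_setoidStabilizer u)) ?_), ?_⟩
  · rw [← h₁, h₂]
    exact (hconj _).trans (centralizer_le_setoidStabilizer _)
  · intro B hB
    obtain ⟨x, -, rfl⟩ := Finset.mem_image.mp hB
    rw [← ncard_sameCycle_eq hp hu hufix x, ← Set.ncard_coe_finset]
    congr 1
    ext y
    simp only [Finset.coe_filter, Finset.mem_univ, true_and]
    rfl
end

section
/- Let p ≥ 11 be a prime and H = ℤ_2³ × ℤ_p. For every permutation φ of H, there exists δ ∈ ⟨H_L, φ⁻¹H_Lφ⟩ such that the group ⟨H_L, δ⁻¹φ⁻¹H_Lφδ⟩ admits a complete block system consisting of 8 blocks of size p. -/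
/-- Two `p`-subgroups of `G` lie, up to conjugation by an element of `G`, in a common `p`-subgroup. -/
theorem exists_conj_mem_common_isPGroup {Γ : Type*} [Group Γ] [Finite Γ] {p : ℕ}
    [Fact p.Prime] {G P P' : Subgroup Γ} (hPG : P ≤ G) (hPG' : P' ≤ G)
    (hP : IsPGroup p P) (hP' : IsPGroup p P') :
    ∃ g ∈ G, ∃ Q : Subgroup Γ, IsPGroup p Q ∧ P ≤ Q ∧ ∀ x ∈ P', g * x * g⁻¹ ∈ Q := by
  obtain ⟨Q, hQ⟩ := (hP.comap_subtype (K := G)).exists_le_sylow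
  obtain ⟨Q', hQ'⟩ := (hP'.comap_subtype (K := G)).exists_le_sylow
  obtain ⟨g, hg⟩ := MulAction.exists_smul_eq G Q' Q
  refine ⟨g, g.2, (Q : Subgroup G).map G.subtype, Q.2.map _, fun x hx => ?_, fun x hx => ?_⟩
  · exact ⟨⟨x, hPG hx⟩, hQ (Subgroup.mem_comap.2 hx), rfl⟩
  · refine ⟨g * ⟨x, hPG' hx⟩ * g⁻¹, ?_, rfl⟩
    rw [← hg, Sylow.coe_subgroup_smul]
    exact Subgroup.smul_mem_pointwise_smul _ (MulAut.conj g) _ (hQ' (Subgroup.mem_comap.2 hx))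

/-- An orbit of a `p`-group on fewer than `p ^ 2` points has at most `p` elements. -/
theorem IsPGroup.ncard_orbit_le {Γ Ω : Type*} [Group Γ] [MulAction Γ Ω] [Finite Ω] {p : ℕ}
    [Fact p.Prime] (hΓ : IsPGroup p Γ) (hΩ : Nat.card Ω < p ^ 2) (x : Ω) :
    (MulAction.orbit Γ x).ncard ≤ p := by
  obtain ⟨n, hn⟩ := hΓ.card_orbit x
  have hp := (Fact.out : p.Prime)
  have hle : (MulAction.orbit Γ x).ncard ≤ Nat.card Ω := Set.ncard_le_card _
  rw [← Nat.card_coe_set_eq, hn] at hle ⊢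
  have hlt : n < 2 := (Nat.pow_lt_pow_iff_right hp.one_lt).1 (hle.trans_lt hΩ)
  calc p ^ n ≤ p ^ 1 := Nat.pow_le_pow_right hp.pos (by omega)
    _ = p := pow_one p

/-- The permutations that permute the fibres of `f`. -/
def fibrePreserving {Ω A : Type*} (f : Ω → A) : Subgroup (Equiv.Perm Ω) where
  carrier := {g | ∀ x y, f (g x) = f (g y) ↔ f x = f y}
  mul_mem' ha hb x y := (ha _ _).trans (hb x y)
  one_mem' _ _ := Iff.rfl
  inv_mem' {a} ha x y := by simpa using (ha (a⁻¹ x) (a⁻¹ y)).symm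

/-- The fibres of a surjection form a complete block system for every group permuting them. -/
theorem isCompleteBlockSystem_fibres {Ω A : Type*} [DecidableEq Ω] [Fintype Ω] [Fintype A]
    [DecidableEq A] {f : Ω → A} (hf : Function.Surjective f) {K : Subgroup (Equiv.Perm Ω)}
    (hK : K ≤ fibrePreserving f) :
    IsCompleteBlockSystem K
      (Finset.univ.image fun a => Finset.univ.filter fun x => f x = a) := by
  refine ⟨fun x => ⟨Finset.univ.filter fun y => f y = f x, by simp, ?_⟩, ?_⟩
  · rintro B ⟨hB, hx⟩
    obtain ⟨a, -, rfl⟩ := Finset.mem_image.1 hB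
    simp only [Finset.mem_filter, Finset.mem_univ, true_and] at hx
    rw [hx]
  · intro B hB g hg
    obtain ⟨a, -, rfl⟩ := Finset.mem_image.1 hB
    obtain ⟨x, rfl⟩ := hf a
    refine Finset.mem_image.2 ⟨f (g x), Finset.mem_univ _, ?_⟩
    ext y
    simp only [Finset.mem_filter, Finset.mem_univ, true_and, Finset.mem_image]
    constructor
    · intro hy
      exact ⟨g⁻¹ y, (hK hg _ _).1 (by simpa using hy), by simp⟩
    · rintro ⟨z, hz, rfl⟩
      exact (hK hg _ _).2 hz

section

variable {H A : Type*} [Group H] [Group A]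

theorem leftRegular_le_fibrePreserving (f : H →* A) : leftRegular H ≤ fibrePreserving f := by
  rintro _ ⟨h, rfl⟩ x y
  simp

/-- A `p`-group of permutations of `H` containing the translations by `f.ker`, of order `p`,
preserves every fibre of `f`. -/
theorem map_apply_eq_of_mem_isPGroup [Finite H] {p : ℕ} [Fact p.Prime] {f : H →* A}
    (hker : Nat.card f.ker = p) (hH : Nat.card H < p ^ 2) {Q : Subgroup (Equiv.Perm H)}
    (hQ : IsPGroup p Q) (hle : f.ker.map (MulAction.toPermHom H H) ≤ Q)
    {q : Equiv.Perm H} (hq : q ∈ Q) (x : H) : f (q x) = f x := by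
  have hsub : (fun k => k * x) '' (f.ker : Set H) ⊆ MulAction.orbit Q x := by
    rintro _ ⟨k, hk, rfl⟩
    exact ⟨⟨_, hle ⟨k, hk, rfl⟩⟩, rfl⟩
  have hcard : ((fun k => k * x) '' (f.ker : Set H)).ncard = p := by
    rw [Set.ncard_image_of_injective _ (mul_left_injective x), ← Nat.card_coe_set_eq]
    exact hker
  have heq := Set.eq_of_subset_of_ncard_le hsub
    ((hQ.ncard_orbit_le hH x).trans hcard.ge) (Set.toFinite _)
  have hmem : q x ∈ MulAction.orbit Q x := ⟨⟨q, hq⟩, rfl⟩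
  rw [← heq] at hmem
  obtain ⟨k, hk, hkx⟩ := hmem
  rw [← hkx, map_mul, show f k = 1 from hk, one_mul]

/-- If every fibre of `f` is preserved by the `ψ`-conjugates of the translations by `f.ker`, then
the `ψ`-conjugate of the left regular representation permutes the fibres of `f`. -/
theorem conjBy_leftRegular_le_fibrePreserving [Finite A] {f : H →* A}
    (hf : Function.Surjective f) {ψ : Equiv.Perm H}
    (hψ : ∀ k ∈ f.ker, ∀ x, f (ψ⁻¹ (k * ψ x)) = f x) :
    conjBy ψ (leftRegular H) ≤ fibrePreserving f := by
  have hfactor : ∀ x y, f x = f y → f (ψ⁻¹ x) = f (ψ⁻¹ y) := fun x y hxy => by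
    have := hψ (x * y⁻¹) (by simp [MonoidHom.mem_ker, hxy]) (ψ⁻¹ y)
    simpa using this
  let σ : A → A := fun a => f (ψ⁻¹ (Function.surjInv hf a))
  have hσ : ∀ x, σ (f x) = f (ψ⁻¹ x) := fun x => hfactor _ _ (Function.surjInv_eq hf _)
  have hσinj : Function.Injective σ := by
    refine Finite.injective_iff_surjective.2 fun a => ?_
    obtain ⟨x, rfl⟩ := hf a
    exact ⟨f (ψ x), by simp [hσ]⟩
  have hiff : ∀ x y, f (ψ⁻¹ x) = f (ψ⁻¹ y) ↔ f x = f y := fun x y => by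
    rw [← hσ, ← hσ, hσinj.eq_iff]
  have hmem : ψ⁻¹ ∈ fibrePreserving f := hiff
  rintro _ ⟨g, hg, rfl⟩
  exact mul_mem (mul_mem hmem (leftRegular_le_fibrePreserving f hg)) (inv_mem hmem)

/-- If `f.ker` has prime order `p` and `|H| < p ^ 2`, every conjugate of the left regular
representation can be moved within the group generated so that both permute the fibres of `f`. -/
theorem exists_sup_conjBy_le_fibrePreserving [Finite H] {p : ℕ} [Fact p.Prime] {f : H →* A}
    (hf : Function.Surjective f) (hker : Nat.card f.ker = p) (hH : Nat.card H < p ^ 2)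
    (φ : Equiv.Perm H) :
    ∃ δ ∈ leftRegular H ⊔ conjBy φ (leftRegular H),
      leftRegular H ⊔ conjBy (φ * δ) (leftRegular H) ≤ fibrePreserving f := by
  have := Finite.of_surjective f hf
  let P := f.ker.map (MulAction.toPermHom H H)
  have hP : IsPGroup p P := (IsPGroup.of_card (n := 1) (by rw [hker, pow_one])).map _
  have hPle : P ≤ leftRegular H := Subgroup.map_le_range _ _
  obtain ⟨g, hg, Q, hQ, hPQ, hPQ'⟩ := exists_conj_mem_common_isPGroup
    (hPle.trans le_sup_left) ((Subgroup.map_mono hPle).trans le_sup_right) hP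
    (hP.map (MulAut.conj φ⁻¹).toMonoidHom)
  refine ⟨g⁻¹, inv_mem hg, sup_le (leftRegular_le_fibrePreserving f)
    (conjBy_leftRegular_le_fibrePreserving hf fun k hk x => ?_)⟩
  have hq := hPQ' _ ⟨_, ⟨k, hk, rfl⟩, rfl⟩
  simpa using map_apply_eq_of_mem_isPGroup hker hH hQ hPQ hq x

theorem card_filter_map_eq [Fintype H] [DecidableEq A] (f : H →* A)
    (hf : Function.Surjective f) (a : A) :
    (Finset.univ.filter fun x => f x = a).card = Nat.card f.ker := by
  rw [← Nat.card_congr (f.fiberEquivKerOfSurjective hf a)]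
  simp [Set.preimage]

end

theorem statement_12 (p : ℕ) (hp : p.Prime) (hp11 : 11 ≤ p)
    (φ : Equiv.Perm (Hgrp p)) :
    ∃ δ ∈ leftRegular (Hgrp p) ⊔ conjBy φ (leftRegular (Hgrp p)),
      ∃ ℬ : Finset (Finset (Hgrp p)),
        IsCompleteBlockSystem
          (leftRegular (Hgrp p) ⊔ conjBy (φ * δ) (leftRegular (Hgrp p))) ℬ ∧
        ℬ.card = 8 ∧ ∀ B ∈ ℬ, B.card = p := by
  have : Fact p.Prime := ⟨hp⟩
  let f : Hgrp p →* Multiplicative (ZMod 2 × ZMod 2 × ZMod 2) :=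
    AddMonoidHom.toMultiplicative (AddMonoidHom.fst _ _)
  have hf : Function.Surjective f := fun a => ⟨Multiplicative.ofAdd (a.toAdd, 0), rfl⟩
  have hA : Nat.card (Multiplicative (ZMod 2 × ZMod 2 × ZMod 2)) = 8 := by simp
  have hH : Nat.card (Hgrp p) = 8 * p := by
    rw [Nat.card_congr Multiplicative.toAdd]
    simp
  have : Fintype (Hgrp p) := inferInstanceAs (Fintype ((ZMod 2 × ZMod 2 × ZMod 2) × ZMod p))
  have hker : Nat.card f.ker = p := by
    have h := f.ker.card_eq_card_quotient_mul_card_subgroup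
    rw [Nat.card_congr (QuotientGroup.quotientKerEquivOfSurjective f hf).toEquiv, hA, hH] at h
    omega
  obtain ⟨δ, hδ, hle⟩ := exists_sup_conjBy_le_fibrePreserving hf hker (by rw [hH]; nlinarith) φ
  refine ⟨δ, hδ, _, isCompleteBlockSystem_fibres hf hle, ?_, ?_⟩
  · rw [Finset.card_image_of_injective, Finset.card_univ, ← Nat.card_eq_fintype_card, hA]
    intro a b hab
    obtain ⟨x, rfl⟩ := hf a
    have hx := Finset.ext_iff.1 hab x
    simpa using hx
  · intro B hB
    obtain ⟨a, -, rfl⟩ := Finset.mem_image.1 hB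
    rw [card_filter_map_eq f hf, hker]
end
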